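/- arXiv:1812.09246 — 2 statements merged into one kernel-verified Lean document; each statement's English description precedes it below -/
import Mathlib

section
/- Let n ≥ 2, let X ⊂ S^n be an (n−1)-dimensional Sierpiński space with complementary connected components U_i, i ∈ ℕ, and let N ∈ ℕ. Then there exists a continuous surjection p : S^n → S^n such that: p(x) = x for every x ∈ ⋃_{j=1}^{N} closure(U_j); there exist points q_j ∈ S^n, j ≥ N+1, with p^{-1}(q_j) = closure(U_j) for every j ≥ N+1; and p restricted to S^n \ ⋃_{j≥N+1} closure(U_j) is a bijection onto S^n \ {q_j : j ≥ N+1}. -/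
open Metric Set Topology Filter MeasureTheory

noncomputable section

abbrev Euc (n : ℕ) : Type := EuclideanSpace ℝ (Fin n)

abbrev Sph (n : ℕ) : Set (Euc (n+1)) := Metric.sphere 0 1

/-- The subtype of `A` is an `n`-cell: homeomorphic to the cube `[0,1]^n`. -/
def IsCell (n : ℕ) {α : Type*} [TopologicalSpace α] (A : Set α) : Prop :=
  Nonempty (↥A ≃ₜ (Fin n → ↥(Set.Icc (0:ℝ) 1)))

/-- The collection of connected components of a set `A`. -/
def compsOf {α : Type*} [TopologicalSpace α] (A : Set α) : Set (Set α) :=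
  {V | ∃ x ∈ A, V = connectedComponentIn A x}

/-- The connected components of the complement `S^n \ X`. -/
def connComps (n : ℕ) (X : Set (Euc (n+1))) : Set (Set (Euc (n+1))) :=
  compsOf ((Sph n) \ X)

/-- `X ⊆ S^n` is an `(n-1)`-dimensional Sierpiński space. -/
structure IsSierpinski (n : ℕ) (X : Set (Euc (n+1))) : Prop where
  subset : X ⊆ Sph n
  isCompact : IsCompact X
  isConnected : IsConnected X
  exists_enum : ∃ U : ℕ → Set (Euc (n+1)),
    Function.Injective U ∧
    (∀ i, U i ∈ connComps n X) ∧
    (∀ V ∈ connComps n X, ∃ i, V = U i) ∧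
    (∀ i, IsCell n ((Sph n) \ U i)) ∧
    (∀ i j, i ≠ j → closure (U i) ∩ closure (U j) = ∅) ∧
    (Sph n) ⊆ closure (⋃ i, U i) ∧
    Filter.Tendsto (fun i => Metric.diam (U i)) Filter.atTop (nhds 0)





namespace InvDom

/-- The determinant of `1 + tA` is a polynomial in `t` of degree at most `n`. -/
lemma det_poly {n : ℕ} (A : Euc n →L[ℝ] Euc n) :
    ∃ p : Polynomial ℝ, p.degree < (n + 1 : ℕ) ∧
      ∀ t : ℝ, p.eval t = (ContinuousLinearMap.id ℝ (Euc n) + t • A).det := by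
  classical
  let b := (EuclideanSpace.basisFun (Fin n) ℝ).toBasis
  let M := LinearMap.toMatrix b b (A : Euc n →ₗ[ℝ] Euc n)
  refine ⟨Matrix.det ((Polynomial.X : Polynomial ℝ) • M.map Polynomial.C +
    (1 : Matrix (Fin n) (Fin n) ℝ).map Polynomial.C), ?_, ?_⟩
  · have h := Polynomial.natDegree_det_X_add_C_le M (1 : Matrix (Fin n) (Fin n) ℝ)
    rw [Fintype.card_fin] at h
    refine lt_of_le_of_lt Polynomial.degree_le_natDegree ?_
    exact_mod_cast Nat.lt_succ_of_le h
  · intro t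
    rw [ContinuousLinearMap.det, ← LinearMap.det_toMatrix b]
    have e1 : LinearMap.toMatrix b b
        ((ContinuousLinearMap.id ℝ (Euc n) + t • A : Euc n →L[ℝ] Euc n) : Euc n →ₗ[ℝ] Euc n)
        = t • M + 1 := by
      rw [ContinuousLinearMap.toLinearMap_add, ContinuousLinearMap.toLinearMap_smul, map_add, map_smul]
      rw [show ((ContinuousLinearMap.id ℝ (Euc n) : Euc n →L[ℝ] Euc n) : Euc n →ₗ[ℝ] Euc n)
        = LinearMap.id from rfl, LinearMap.toMatrix_id, add_comm]
    rw [e1, ← Polynomial.coe_evalRingHom, RingHom.map_det]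
    congr 1
    ext i j
    by_cases hij : i = j <;> simp [hij] <;> ring_nf

lemma det_interp (n : ℕ) (v : Fin (n+1) → ℝ) (hv : Function.Injective v) :
    ∃ c : Fin (n+1) → ℝ, (∑ i, c i = 1) ∧ ∀ A : Euc n →L[ℝ] Euc n,
      (ContinuousLinearMap.id ℝ (Euc n) + (1:ℝ) • A).det =
        ∑ i, c i * (ContinuousLinearMap.id ℝ (Euc n) + v i • A).det := by
  classical
  refine ⟨fun i => (Lagrange.basis Finset.univ v i).eval 1, ?_, ?_⟩
  · have := Lagrange.sum_basis (s := Finset.univ) (v := v) hv.injOn Finset.univ_nonempty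
    rw [← Polynomial.eval_finsetSum, this, Polynomial.eval_one]
  · intro A
    obtain ⟨p, hp, hpe⟩ := det_poly A
    have := Lagrange.eq_interpolate (s := Finset.univ) (v := v) (f := p) hv.injOn (by simpa using hp)
    rw [← hpe, this, Lagrange.interpolate_apply, Polynomial.eval_finsetSum]
    refine Finset.sum_congr rfl fun i _ => ?_
    rw [Polynomial.eval_mul, Polynomial.eval_C, hpe, mul_comm]

lemma det_pos_of_small {n : ℕ} (A : Euc n →L[ℝ] Euc n) (t : ℝ) (ht : 0 ≤ t)
    (hA : t * ‖A‖ < 1) : 0 < (ContinuousLinearMap.id ℝ (Euc n) + t • A).det := by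
  obtain ⟨p, -, hpe⟩ := det_poly A
  have hne : ∀ s ∈ Icc 0 t, p.eval s ≠ 0 := by
    intro s hs h0
    rw [hpe, ContinuousLinearMap.det] at h0
    have := LinearMap.bot_lt_ker_of_det_eq_zero h0
    obtain ⟨x, hx, hx0⟩ := (Submodule.ne_bot_iff _).1 this.ne'
    have hx' : x + s • A x = 0 := by simpa using hx
    have h1 : ‖x‖ = ‖s • A x‖ := by
      rw [← norm_neg (s • A x), ← eq_neg_of_add_eq_zero_left hx']
    rw [norm_smul, Real.norm_of_nonneg hs.1] at h1
    have h2 : s * ‖A x‖ ≤ t * (‖A‖ * ‖x‖) := by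
      gcongr
      · exact hs.2
      · exact A.le_opNorm x
    have : 0 < ‖x‖ := norm_pos_iff.2 hx0
    nlinarith
  have h0 : p.eval 0 = 1 := by rw [hpe]; simp [ContinuousLinearMap.det]
  rw [← hpe]
  by_contra hcon
  push Not at hcon
  obtain ⟨s, hs, hs0⟩ := intermediate_value_Icc' ht (p.continuous.continuousOn (s := Icc 0 t))
    (show (0:ℝ) ∈ Icc (p.eval t) (p.eval 0) from ⟨hcon, by rw [h0]; norm_num⟩)
  exact hne s hs hs0

theorem no_retraction {n : ℕ} (r : Euc n → Euc n) (hr : ContDiff ℝ 1 r)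
    (h1 : ∀ x, ‖r x‖ = 1) (h2 : ∀ x, ‖x‖ = 1 → r x = x) : False := by
  set u : Euc n → Euc n := fun x => r x - x with hu
  have hu1 : ContDiff ℝ 1 u := hr.sub contDiff_id
  have hdu : Continuous (fderiv ℝ u) := hu1.continuous_fderiv (by norm_num)
  obtain ⟨C, hC⟩ := (isCompact_closedBall (0 : Euc n) 1).exists_bound_of_continuousOn
    (f := fderiv ℝ u) hdu.continuousOn
  have hC0 : 0 ≤ C := (norm_nonneg _).trans (hC 0 (by simp))
  have hud : ∀ x, HasFDerivAt u (fderiv ℝ u x) x := fun x =>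
    (hu1.differentiable (by norm_num) x).hasFDerivAt
  have hlip : ∀ x ∈ closedBall (0 : Euc n) 1, ∀ y ∈ closedBall (0 : Euc n) 1,
      ‖u y - u x‖ ≤ C * ‖y - x‖ := by
    intro x hx y hy
    exact (convex_closedBall (0 : Euc n) 1).norm_image_sub_le_of_norm_hasFDerivWithin_le
      (fun z _ => (hud z).hasFDerivWithinAt) (fun z hz => hC z hz) hx hy
  have key : ∀ t : ℝ, 0 < t → t * (C + 1) < 1 →
      ∫ x in ball (0 : Euc n) 1, (ContinuousLinearMap.id ℝ (Euc n) + t • fderiv ℝ u x).det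
        = volume.real (ball (0 : Euc n) 1) := by
    intro t ht htC
    set f : Euc n → Euc n := fun x => x + t • u x with hf
    have ht1 : t < 1 := by nlinarith
    have hfd : ∀ x, HasFDerivAt f (ContinuousLinearMap.id ℝ (Euc n) + t • fderiv ℝ u x) x :=
      fun x => (hasFDerivAt_id x).add ((hud x).const_smul t)
    have hfc : ContDiff ℝ 1 f := contDiff_id.add (hu1.const_smul t)
    have hpos : ∀ x ∈ ball (0 : Euc n) 1,
        0 < (ContinuousLinearMap.id ℝ (Euc n) + t • fderiv ℝ u x).det := by
      intro x hx
      refine det_pos_of_small _ t ht.le ?_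
      have := hC x (ball_subset_closedBall hx)
      nlinarith
    have hinj : InjOn f (closedBall (0 : Euc n) 1) := by
      intro x hx y hy hxy
      have h3 : y - x = t • (u x - u y) := by
        have : x + t • u x = y + t • u y := hxy
        rw [smul_sub, sub_eq_sub_iff_add_eq_add, ← this, add_comm]
      have h4 : ‖y - x‖ ≤ t * (C * ‖y - x‖) := by
        calc ‖y - x‖ = t * ‖u x - u y‖ := by
              conv_lhs => rw [h3, norm_smul, Real.norm_of_nonneg ht.le]
          _ ≤ t * (C * ‖y - x‖) := by
              gcongr
              rw [norm_sub_rev]; exact hlip x hx y hy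
      have h5 : ‖y - x‖ = 0 := by
        have := norm_nonneg (y - x)
        nlinarith
      exact (sub_eq_zero.1 (norm_eq_zero.1 h5)).symm
    have hfball : f '' ball (0 : Euc n) 1 = ball (0 : Euc n) 1 := by
      apply Subset.antisymm
      · rintro _ ⟨x, hx, rfl⟩
        have : f x = (1 - t) • x + t • r x := by
          simp only [hf, hu, smul_sub, sub_smul, one_smul]; abel
        rw [mem_ball_zero_iff] at hx ⊢
        rw [this]
        calc ‖(1 - t) • x + t • r x‖ ≤ ‖(1 - t) • x‖ + ‖t • r x‖ := norm_add_le _ _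
          _ = (1 - t) * ‖x‖ + t := by
            rw [norm_smul, norm_smul, h1, Real.norm_of_nonneg ht.le,
              Real.norm_of_nonneg (by linarith), mul_one]
          _ < 1 := by nlinarith
      · have hopen : IsOpen (f '' ball (0 : Euc n) 1) := by
          rw [isOpen_iff_mem_nhds]
          rintro _ ⟨x, hx, rfl⟩
          have hs : HasStrictFDerivAt f
              (ContinuousLinearMap.id ℝ (Euc n) + t • fderiv ℝ u x) x :=
            hfc.contDiffAt.hasStrictFDerivAt' (hfd x) (by norm_num)
          have hsurj : ((ContinuousLinearMap.id ℝ (Euc n) + t • fderiv ℝ u x :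
              Euc n →L[ℝ] Euc n)).range = ⊤ := by
            have hu := (LinearMap.isUnit_iff_isUnit_det _).2 (hpos x hx).ne'.isUnit
            exact (LinearMap.isUnit_iff_range_eq_top _).1 hu
          rw [← hs.map_nhds_eq_of_surj hsurj]
          exact image_mem_map (isOpen_ball.mem_nhds hx)
        have hcl : IsOpen (f '' closedBall (0 : Euc n) 1)ᶜ :=
          (((isCompact_closedBall (0 : Euc n) 1).image hfc.continuous).isClosed).isOpen_compl
        refine IsPreconnected.subset_left_of_subset_union hopen hcl ?_ ?_ ?_
          (convex_ball (0 : Euc n) 1).isPreconnected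
        · rw [disjoint_compl_right_iff_subset]
          exact image_mono ball_subset_closedBall
        · intro y hy
          by_cases h : y ∈ f '' closedBall (0 : Euc n) 1
          · left
            obtain ⟨x, hx, rfl⟩ := h
            refine ⟨x, ?_, rfl⟩
            rw [mem_closedBall_zero_iff] at hx
            rw [mem_ball_zero_iff] at hy ⊢
            refine lt_of_le_of_ne hx fun hx1 => ?_
            have : f x = x := by simp [hf, hu, h2 x hx1]
            rw [this] at hy
            linarith
          · exact Or.inr h
        · have h0 : f 0 ∈ ball (0 : Euc n) 1 := by
            have : f 0 = t • r 0 := by simp [hf, hu]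
            rw [mem_ball_zero_iff, this, norm_smul, h1, Real.norm_of_nonneg ht.le]
            linarith
          exact ⟨f 0, h0, mem_image_of_mem f (by simp)⟩
    have hcv := integral_image_eq_integral_abs_det_fderiv_smul (μ := volume)
      (s := ball (0 : Euc n) 1) (f := f) measurableSet_ball
      (fun x _ => (hfd x).hasFDerivWithinAt) (hinj.mono ball_subset_closedBall) (fun _ => (1:ℝ))
    rw [hfball] at hcv
    simp only [smul_eq_mul, mul_one] at hcv
    rw [setIntegral_const, smul_eq_mul, mul_one] at hcv
    rw [hcv]
    refine setIntegral_congr_fun measurableSet_ball fun x hx => ?_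
    exact (abs_of_pos (hpos x hx)).symm
  set t0 : ℝ := 1 / (C + 1) with ht0
  have ht0p : 0 < t0 := by positivity
  let v : Fin (n+1) → ℝ := fun i => t0 * ((i : ℝ) + 1) / (n + 2)
  have hv : Function.Injective v := by
    intro i j hij
    simp only [v] at hij
    have hn : (0:ℝ) < n + 2 := by positivity
    field_simp at hij
    have : (i:ℝ) = j := by linarith
    exact Fin.ext (by exact_mod_cast this)
  obtain ⟨c, hc1, hc⟩ := det_interp n v hv
  have hkv : ∀ i, ∫ x in ball (0 : Euc n) 1,
      (ContinuousLinearMap.id ℝ (Euc n) + v i • fderiv ℝ u x).det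
        = volume.real (ball (0 : Euc n) 1) := by
    intro i
    refine key _ (by simp only [v]; positivity) ?_
    have hi : (i:ℝ) + 1 < n + 2 := by
      have : (i:ℕ) < n + 1 := i.2
      have : (i:ℝ) < n + 1 := by exact_mod_cast this
      linarith
    simp only [v, ht0]
    have hn : (0:ℝ) < n + 2 := by positivity
    have hCC : (0:ℝ) < C + 1 := by positivity
    rw [show 1 / (C+1) * ((i:ℝ)+1) / (n+2) * (C+1) = ((i:ℝ)+1)/(n+2) by field_simp]
    rw [div_lt_one hn]; exact hi
  have hdetc : ∀ t : ℝ, IntegrableOn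
      (fun x => (ContinuousLinearMap.id ℝ (Euc n) + t • fderiv ℝ u x).det)
      (ball (0 : Euc n) 1) := by
    intro t
    have hc : Continuous
        (fun x => (ContinuousLinearMap.id ℝ (Euc n) + t • fderiv ℝ u x).det) :=
      ContinuousLinearMap.continuous_det.comp (by fun_prop)
    exact (hc.continuousOn.integrableOn_compact (isCompact_closedBall (0 : Euc n) 1)).mono_set
      ball_subset_closedBall
  have hone : ∫ x in ball (0 : Euc n) 1,
      (ContinuousLinearMap.id ℝ (Euc n) + (1:ℝ) • fderiv ℝ u x).det
        = volume.real (ball (0 : Euc n) 1) := by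
    simp_rw [hc]
    rw [integral_finsetSum _ (fun i _ => (hdetc (v i)).const_mul (c i))]
    simp_rw [integral_const_mul, hkv, ← Finset.sum_mul, hc1, one_mul]
  have hzero : ∀ x, (ContinuousLinearMap.id ℝ (Euc n) + (1:ℝ) • fderiv ℝ u x).det = 0 := by
    intro x
    by_contra hne
    have hrd : HasFDerivAt r (ContinuousLinearMap.id ℝ (Euc n) + (1:ℝ) • fderiv ℝ u x) x := by
      have := (hasFDerivAt_id x).add ((hud x).const_smul (1:ℝ))
      refine this.congr_of_eventuallyEq (Eventually.of_forall fun y => ?_)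
      simp [hu]
    set L := (ContinuousLinearMap.id ℝ (Euc n) + (1:ℝ) • fderiv ℝ u x)
    have hsurj : Function.Surjective L := by
      have hu := (LinearMap.isUnit_iff_isUnit_det _).2 (Ne.isUnit hne)
      exact LinearMap.range_eq_top.1 ((LinearMap.isUnit_iff_range_eq_top _).1 hu)
    obtain ⟨w, hw⟩ := hsurj (r x)
    have h3 : HasFDerivAt (fun y => inner ℝ (r y) (r y)) _ x := hrd.inner ℝ hrd
    have h4 : HasFDerivAt (fun y => inner ℝ (r y) (r y)) (0 : Euc n →L[ℝ] ℝ) x := by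
      refine (hasFDerivAt_const (1:ℝ) x).congr_of_eventuallyEq (Eventually.of_forall fun y => ?_)
      simp [h1]
    have h5 := congrArg (fun T => T w) (h3.unique h4)
    simp [hw, h1, fderivInnerCLM_apply] at h5
  simp_rw [hzero] at hone
  simp only [integral_zero] at hone
  have : 0 < volume.real (ball (0 : Euc n) 1) :=
    ENNReal.toReal_pos (measure_ball_pos _ _ one_pos).ne' measure_ball_lt_top.ne
  linarith

/-- A continuous map close to the identity on the unit ball has a zero. -/
theorem exists_zero {n : ℕ} (F : Euc n → Euc n) (hF : ContinuousOn F (closedBall 0 1))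
    (hclose : ∀ x ∈ closedBall (0 : Euc n) 1, ‖F x - x‖ ≤ 1/2) :
    ∃ x ∈ closedBall (0 : Euc n) 1, F x = 0 := by
  by_contra hcon
  push Not at hcon
  let χ : Euc n → ℝ := fun x => max 0 (min 1 (5 * (4/5 - ‖x‖)))
  have hχc : Continuous χ := by fun_prop
  have hχ0 : ∀ x, 0 ≤ χ x := fun x => le_max_left _ _
  have hχ1 : ∀ x, χ x ≤ 1 := fun x => max_le zero_le_one (min_le_left _ _)
  have hχz : ∀ x, 4/5 ≤ ‖x‖ → χ x = 0 := fun x hx => by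
    refine max_eq_left ((min_le_right _ _).trans (by linarith))
  have hχo : ∀ x, ‖x‖ ≤ 3/5 → χ x = 1 := fun x hx => by
    simp only [χ]; rw [min_eq_left (by linarith)]; norm_num
  let H : Euc n → Euc n := fun x => x + χ x • (F x - x)
  have hHid : ∀ x, 4/5 ≤ ‖x‖ → H x = x := fun x hx => by simp [H, hχz x hx]
  have hHc : Continuous H := by
    rw [continuous_iff_continuousAt]
    intro x
    by_cases hx : ‖x‖ < 1
    · have hxn : closedBall (0 : Euc n) 1 ∈ 𝓝 x :=
        mem_of_superset (isOpen_ball.mem_nhds (mem_ball_zero_iff.2 hx)) ball_subset_closedBall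
      have := hF.continuousAt hxn
      exact continuousAt_id.add (hχc.continuousAt.smul (this.sub continuousAt_id))
    · have : H =ᶠ[𝓝 x] id := by
        have : {y : Euc n | 4/5 < ‖y‖} ∈ 𝓝 x :=
          (isOpen_lt continuous_const continuous_norm).mem_nhds (by
            show 4/5 < ‖_‖
            linarith)
        filter_upwards [this] with y hy using hHid y (le_of_lt hy)
      exact continuousAt_id.congr this.symm
  have hHne : ∀ x, H x ≠ 0 := by
    intro x hx
    by_cases h1 : ‖x‖ ≤ 3/5
    · have : H x = F x := by simp [H, hχo x h1]
      rw [this] at hx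
      exact hcon x (mem_closedBall_zero_iff.2 (by linarith)) hx
    · by_cases h2 : 4/5 ≤ ‖x‖
      · rw [hHid x h2] at hx
        rw [hx] at h2; norm_num at h2
      · have h3 : ‖x‖ = ‖χ x • (F x - x)‖ := by
          rw [← norm_neg (χ x • (F x - x)), ← eq_neg_of_add_eq_zero_left hx]
        rw [norm_smul, Real.norm_of_nonneg (hχ0 x)] at h3
        have h4 := hclose x (mem_closedBall_zero_iff.2 (by linarith))
        have := hχ1 x
        have := hχ0 x
        have := norm_nonneg (F x - x)
        nlinarith
  obtain ⟨m, hm, hmH⟩ : ∃ m > 0, ∀ x ∈ closedBall (0 : Euc n) 1, m ≤ ‖H x‖ := by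
    obtain ⟨x0, -, hx0⟩ := (isCompact_closedBall (0 : Euc n) 1).exists_isMinOn
      ⟨0, by simp⟩ (hHc.norm.continuousOn)
    exact ⟨‖H x0‖, norm_pos_iff.2 (hHne x0), fun x hx => hx0 hx⟩
  have hSc : IsClosed {x : Euc n | 1 ≤ ‖x‖} := isClosed_le continuous_const continuous_norm
  have hUo : IsOpen {x : Euc n | 4/5 < ‖x‖} := isOpen_lt continuous_const continuous_norm
  obtain ⟨g, hg, hgapp, hgeq, -⟩ := hHc.exists_contDiff_approx_and_eqOn (ε := fun _ => m) 1
    continuous_const (fun _ => hm) hSc (U := {x : Euc n | 4/5 < ‖x‖})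
    (hUo.mem_nhdsSet.2 fun x (hx : 1 ≤ ‖x‖) => by
            show 4/5 < ‖_‖
            linarith)
    (contDiffOn_id.congr fun x hx => hHid x (le_of_lt hx))
  have hgne : ∀ x, g x ≠ 0 := by
    intro x hx
    by_cases h : 1 ≤ ‖x‖
    · have := hgeq h
      rw [this, hHid x (by linarith)] at hx
      rw [hx] at h; norm_num at h
    · have h1 := hgapp x
      have h2 := hmH x (mem_closedBall_zero_iff.2 (by linarith))
      rw [hx, dist_zero_left] at h1
      linarith
  refine no_retraction (fun x => ‖g x‖⁻¹ • g x) ?_ ?_ ?_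
  · exact ((hg.norm ℝ hgne).inv (fun x => norm_ne_zero_iff.2 (hgne x))).smul hg
  · intro x
    rw [norm_smul, norm_inv, norm_norm, inv_mul_cancel₀ (norm_ne_zero_iff.2 (hgne x))]
  · intro x hx
    have : g x = x := by rw [hgeq (show 1 ≤ ‖x‖ from hx.ge), hHid x (by linarith)]
    simp only [this, hx, inv_one, one_smul]

end InvDom




namespace InvDom

theorem image_closedBall_mem_nhds {n : ℕ} (f : Euc n → Euc n)
    (hf : ContinuousOn f (closedBall 0 1)) (hinj : InjOn f (closedBall 0 1)) :
    f '' closedBall 0 1 ∈ 𝓝 (f 0) := by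
  set B := closedBall (0 : Euc n) 1 with hB
  have hBc : IsCompact B := isCompact_closedBall _ _
  have h0B : (0 : Euc n) ∈ B := by simp [hB]
  obtain ⟨G, hG⟩ : ∃ G : C(Euc n, Euc n), ∀ x ∈ B, G (f x) = x := by
    let fB : B → Euc n := fun x => f x
    have hfB : Continuous fB := continuousOn_iff_continuous_domRestrict.1 hf
    have : CompactSpace B := isCompact_iff_compactSpace.1 hBc
    have hce : IsClosedEmbedding fB :=
      hfB.isClosedEmbedding (fun x y hxy => Subtype.ext (hinj x.2 y.2 hxy))
    obtain ⟨G, hG⟩ := ContinuousMap.exists_extension (Y := Euc n) hce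
      ⟨fun x : B => (x : Euc n), continuous_subtype_val⟩
    exact ⟨G, fun x hx => congrArg (fun k => k ⟨x, hx⟩) hG⟩
  by_contra hcon
  have hGc := G.continuous
  have hG0 : G (f 0) = 0 := hG 0 h0B
  obtain ⟨δ0, hδ0, hGδ0⟩ := Metric.continuousAt_iff.1 (hGc.continuousAt (x := f 0)) (1/10)
    (by norm_num)
  set δ := δ0 / 2 with hδ
  have hδp : 0 < δ := by positivity
  have hGs : ∀ y, dist y (f 0) < 2 * δ → ‖G y‖ ≤ 1/10 := by
    intro y hy
    have := hGδ0 (show dist y (f 0) < δ0 by rw [hδ] at hy; linarith)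
    rw [hG0, dist_zero_right] at this
    exact this.le
  obtain ⟨c, hcd, hcB⟩ : ∃ c, dist c (f 0) < δ ∧ c ∉ f '' B := by
    by_contra h
    push Not at h
    exact hcon (Metric.mem_nhds_iff.2 ⟨δ, hδp, fun y hy => h y hy⟩)
  have hfBc : IsCompact (f '' B) := hBc.image_of_continuousOn hf
  have hSgc : IsCompact (f '' B ∩ {y | δ ≤ dist y c}) :=
    hfBc.inter_right (isClosed_le continuous_const (continuous_id.dist continuous_const))
  obtain ⟨m, hm, hmG⟩ : ∃ m > 0, ∀ y ∈ f '' B ∩ {y | δ ≤ dist y c}, m ≤ ‖G y‖ := by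
    rcases (f '' B ∩ {y | δ ≤ dist y c}).eq_empty_or_nonempty with he | hne
    · exact ⟨1, one_pos, fun y hy => by rw [he] at hy; exact hy.elim⟩
    · obtain ⟨y0, hy0, hmin⟩ := hSgc.exists_isMinOn hne hGc.norm.continuousOn
      refine ⟨‖G y0‖, norm_pos_iff.2 fun h => ?_, fun y hy => hmin hy⟩
      obtain ⟨⟨x, hx, rfl⟩, hd⟩ := hy0
      rw [hG x hx] at h
      rw [h, mem_ofPred_eq, dist_comm] at hd
      linarith
  set a := min (m/3) (1/10) with ha
  have hap : 0 < a := by rw [ha]; positivity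
  have ha1 : a ≤ m/3 := min_le_left _ _
  have ha2 : a ≤ 1/10 := min_le_right _ _
  obtain ⟨P, hP, hPG, -⟩ := hGc.exists_contDiff_approx (ε := fun _ => a) 1
    continuous_const (fun _ => hap)
  obtain ⟨w, hwa, hwP⟩ : ∃ w : Euc n, ‖w‖ < a ∧ w ∉ P '' sphere c δ := by
    by_contra h
    push Not at h
    have h1 : volume (P '' sphere c δ) = 0 :=
      addHaar_image_eq_zero_of_differentiableOn_of_addHaar_eq_zero volume
        (hP.differentiable (by norm_num)).differentiableOn
        (Measure.addHaar_sphere_of_ne_zero volume c hδp.ne')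
    have h2 : ball (0 : Euc n) a ⊆ P '' sphere c δ := fun w hw => h w (mem_ball_zero_iff.1 hw)
    exact (measure_ball_pos volume (0 : Euc n) hap).ne' (measure_mono_null h2 h1)
  let Φ : Euc n → Euc n := fun y => c + max (δ / dist y c) 1 • (y - c)
  have hΦ1 : ∀ y, y ≠ c → δ ≤ dist y c → Φ y = y := by
    intro y hyc hy
    have : 0 < dist y c := dist_pos.2 hyc
    simp only [Φ]
    rw [max_eq_right ((div_le_one this).2 hy), one_smul, add_sub_cancel]
  have hΦ2 : ∀ y, y ≠ c → dist y c < δ → dist (Φ y) c = δ := by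
    intro y hyc hy
    have h0 : 0 < dist y c := dist_pos.2 hyc
    simp only [Φ]
    rw [max_eq_left ((one_le_div h0).2 hy.le), dist_eq_norm, add_sub_cancel_left, norm_smul,
      ← dist_eq_norm, Real.norm_of_nonneg (by positivity)]
    field_simp
  have hne : ∀ x ∈ B, f x ≠ c := fun x hx h => hcB ⟨x, hx, h⟩
  obtain ⟨x, hx, hx0⟩ := exists_zero (fun x => P (Φ (f x)) - w) (by
    refine (hP.continuous.comp_continuousOn ?_).sub continuousOn_const
    have hd : ContinuousOn (fun x => δ / dist (f x) c) B :=
      continuousOn_const.div ((continuous_id.dist continuous_const).comp_continuousOn hf)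
        fun x hx => (dist_pos.2 (hne x hx)).ne'
    have hd2 : ContinuousOn (fun x => max (δ / dist (f x) c) 1) B :=
      ContinuousOn.sup hd continuousOn_const
    show ContinuousOn (fun x => c + max (δ / dist (f x) c) 1 • (f x - c)) B
    fun_prop) (by
    intro x hx
    have hGx := hG x hx
    rcases le_or_gt δ (dist (f x) c) with h | h
    · rw [hΦ1 _ (hne x hx) h]
      have h1 := hPG (f x)
      rw [hGx, dist_eq_norm] at h1
      calc ‖P (f x) - w - x‖ = ‖(P (f x) - x) - w‖ := by congr 1; abel
        _ ≤ ‖P (f x) - x‖ + ‖w‖ := norm_sub_le _ _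
        _ ≤ 1/2 := by linarith
    · have h1 := hΦ2 _ (hne x hx) h
      have h2 := hPG (Φ (f x))
      have h3 := hGs (Φ (f x)) (by
        have := dist_triangle (Φ (f x)) c (f 0)
        linarith)
      have h4 := hGs (f x) (by
        have := dist_triangle (f x) c (f 0)
        linarith)
      rw [hGx] at h4
      rw [dist_eq_norm] at h2
      calc ‖P (Φ (f x)) - w - x‖
          = ‖(P (Φ (f x)) - G (Φ (f x))) + G (Φ (f x)) - w - x‖ := by congr 1; abel
        _ ≤ ‖P (Φ (f x)) - G (Φ (f x))‖ + ‖G (Φ (f x))‖ + ‖w‖ + ‖x‖ := by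
            refine (norm_sub_le _ _).trans ?_
            gcongr
            refine (norm_sub_le _ _).trans ?_
            gcongr
            exact norm_add_le _ _
        _ ≤ 1/2 := by linarith)
  have hPw : P (Φ (f x)) = w := sub_eq_zero.1 hx0
  rcases le_or_gt δ (dist (f x) c) with h | h
  · rw [hΦ1 _ (hne x hx) h] at hPw
    have h1 := hmG (f x) ⟨⟨x, hx, rfl⟩, h⟩
    have h2 := hPG (f x)
    rw [hPw, dist_eq_norm] at h2
    have h3 : ‖G (f x)‖ ≤ ‖w - G (f x)‖ + ‖w‖ := by
      have := norm_sub_le w (w - G (f x))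
      rw [sub_sub_cancel] at this
      linarith
    linarith
  · exact hwP ⟨Φ (f x), mem_sphere.2 (hΦ2 _ (hne x hx) h), hPw⟩

/-- Invariance of domain. -/
theorem isOpen_image {n : ℕ} (f : Euc n → Euc n) (V : Set (Euc n)) (hV : IsOpen V)
    (hf : ContinuousOn f V) (hinj : InjOn f V) : IsOpen (f '' V) := by
  rw [isOpen_iff_mem_nhds]
  rintro _ ⟨x, hx, rfl⟩
  obtain ⟨ρ, hρ, hρV⟩ := Metric.nhds_basis_closedBall.mem_iff.1 (hV.mem_nhds hx)
  have hmap : MapsTo (fun y : Euc n => x + ρ • y) (closedBall 0 1) V := by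
    intro y hy
    apply hρV
    rw [mem_closedBall_zero_iff] at hy
    rw [mem_closedBall, dist_eq_norm, add_sub_cancel_left, norm_smul, Real.norm_of_nonneg hρ.le]
    nlinarith
  have := image_closedBall_mem_nhds (fun y : Euc n => f (x + ρ • y))
    (hf.comp (by fun_prop) hmap) (by
      intro y hy z hz hyz
      have := hinj (hmap hy) (hmap hz) hyz
      exact smul_right_injective _ hρ.ne' (add_left_cancel this))
  simp only [smul_zero, add_zero] at this
  refine mem_of_superset this ?_
  rintro _ ⟨y, hy, rfl⟩
  exact mem_image_of_mem f (hmap hy)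

variable {n : ℕ} {M : Type*} [TopologicalSpace M]

theorem isOpen_image_chart [ChartedSpace (Euc n) M] (h : Euc n → M) (V : Set (Euc n))
    (hV : IsOpen V) (hh : ContinuousOn h V) (hinj : InjOn h V) : IsOpen (h '' V) := by
  rw [isOpen_iff_mem_nhds]
  rintro _ ⟨x, hx, rfl⟩
  let φ := chartAt (Euc n) (h x)
  set V' := V ∩ h ⁻¹' φ.source with hV'
  have hV'o : IsOpen V' := hh.isOpen_inter_preimage hV φ.open_source
  have h1 : IsOpen ((fun y => φ (h y)) '' V') := by
    refine isOpen_image _ _ hV'o ?_ ?_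
    · exact φ.continuousOn.comp (hh.mono inter_subset_left) (fun y hy => hy.2)
    · intro y hy z hz hyz
      exact hinj hy.1 hz.1 (φ.injOn hy.2 hz.2 hyz)
  have h2 : h '' V' = φ.source ∩ φ ⁻¹' ((fun y => φ (h y)) '' V') := by
    ext y
    constructor
    · rintro ⟨z, hz, rfl⟩
      exact ⟨hz.2, ⟨z, hz, rfl⟩⟩
    · rintro ⟨hy, ⟨z, hz, hzy⟩⟩
      exact ⟨z, hz, φ.injOn hz.2 hy hzy⟩
  have h3 : IsOpen (h '' V') := by
    rw [h2]; exact φ.continuousOn.isOpen_inter_preimage φ.open_source h1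
  refine mem_of_superset (h3.mem_nhds ⟨x, ⟨hx, mem_chart_source _ _⟩, rfl⟩)
    (image_mono inter_subset_left)

theorem sphere_subset_closure [T2Space M] [ChartedSpace (Euc n) M] (h : Euc n → M)
    (hh : ContinuousOn h (closedBall 0 1)) (hinj : InjOn h (closedBall 0 1))
    (x : Euc n) (hx : ‖x‖ = 1) : h x ∈ closure (h '' closedBall 0 1)ᶜ := by
  by_contra hcon
  rw [closure_compl, notMem_compl_iff] at hcon
  set B := closedBall (0 : Euc n) 1 with hB
  let φ := chartAt (Euc n) (h x)
  set O := interior (h '' B) ∩ φ.source with hO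
  have hOo : IsOpen O := isOpen_interior.inter φ.open_source
  let k : M → Euc n := Function.invFunOn h B
  have hk : ∀ y ∈ B, k (h y) = y := fun y hy => hinj.leftInvOn_invFunOn hy
  have hkc : ContinuousOn k (h '' B) := by
    have hcomp : CompactSpace B := isCompact_iff_compactSpace.1 (isCompact_closedBall _ _)
    rw [continuousOn_iff_isClosed]
    intro t ht
    refine ⟨h '' (B ∩ t), ?_, ?_⟩
    · exact (((isCompact_closedBall (0 : Euc n) 1).inter_right ht).image_of_continuousOn
        (hh.mono inter_subset_left)).isClosed
    · ext y
      constructor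
      · rintro ⟨hy, ⟨z, hz, rfl⟩⟩
        rw [mem_preimage, hk z hz] at hy
        exact ⟨⟨z, ⟨hz, hy⟩, rfl⟩, ⟨z, hz, rfl⟩⟩
      · rintro ⟨⟨z, hz, rfl⟩, hy⟩
        refine ⟨?_, hy⟩
        rw [mem_preimage, hk z hz.1]; exact hz.2
  set W := φ.target ∩ φ.symm ⁻¹' O with hW
  have hWo : IsOpen W := φ.symm.continuousOn.isOpen_inter_preimage φ.open_target hOo
  have hop : IsOpen ((fun y => k (φ.symm y)) '' W) := by
    refine isOpen_image _ _ hWo ?_ ?_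
    · exact hkc.comp (φ.symm.continuousOn.mono inter_subset_left)
        (fun y hy => interior_subset hy.2.1)
    · intro y hy z hz hyz
      obtain ⟨y', hy', hyy⟩ := interior_subset hy.2.1
      obtain ⟨z', hz', hzz⟩ := interior_subset hz.2.1
      simp only [← hyy, ← hzz, hk y' hy', hk z' hz'] at hyz
      apply φ.symm.injOn hy.1 hz.1
      rw [← hyy, ← hzz, hyz]
  have hsub : (fun y => k (φ.symm y)) '' W ⊆ B := by
    rintro _ ⟨y, hy, rfl⟩
    obtain ⟨y', hy', hyy⟩ := interior_subset hy.2.1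
    simp only [← hyy, hk y' hy']; exact hy'
  have hxB : x ∈ B := by rw [hB, mem_closedBall_zero_iff]; exact hx.le
  have hxW : x ∈ (fun y => k (φ.symm y)) '' W := by
    have hs : h x ∈ φ.source := mem_chart_source _ _
    refine ⟨φ (h x), ⟨φ.map_source hs, ?_⟩, ?_⟩
    · rw [mem_preimage, φ.left_inv hs]; exact ⟨hcon, hs⟩
    · simp only [φ.left_inv hs]; exact hk x hxB
  have hxi : x ∈ interior B := mem_interior.2 ⟨_, hsub, hop, hxW⟩
  rw [hB, interior_closedBall _ one_ne_zero, mem_ball_zero_iff] at hxi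
  linarith

end InvDom




namespace Shrink

variable {n : ℕ}

/-- Normalization of a vector. -/
def nrm (x : Euc n) : Euc n := ‖x‖⁻¹ • x

lemma norm_nrm {x : Euc n} (hx : x ≠ 0) : ‖nrm x‖ = 1 := by
  rw [nrm, norm_smul, norm_inv, norm_norm, inv_mul_cancel₀ (norm_ne_zero_iff.2 hx)]

lemma norm_nrm_le (x : Euc n) : ‖nrm x‖ ≤ 1 := by
  by_cases hx : x = 0
  · simp [nrm, hx]
  · exact (norm_nrm hx).le

lemma nrm_eq_self {x : Euc n} (hx : ‖x‖ = 1) : nrm x = x := by simp [nrm, hx]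

lemma norm_smul_nrm (x : Euc n) : ‖x‖ • nrm x = x := by
  by_cases hx : x = 0
  · simp [nrm, hx]
  · rw [nrm, smul_smul, mul_inv_cancel₀ (norm_ne_zero_iff.2 hx), one_smul]

lemma nrm_smul {c : ℝ} (hc : 0 < c) (x : Euc n) : nrm (c • x) = nrm x := by
  rw [nrm, nrm, norm_smul, Real.norm_of_nonneg hc.le, smul_smul, mul_inv, mul_right_comm,
    inv_mul_cancel₀ hc.ne', one_mul]

lemma nrm_nrm (x : Euc n) : nrm (nrm x) = nrm x := by
  by_cases hx : x = 0
  · simp [nrm, hx]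
  · exact nrm_smul (inv_pos.2 (norm_pos_iff.2 hx)) x

lemma continuousAt_nrm {x : Euc n} (hx : x ≠ 0) : ContinuousAt nrm x := by
  unfold nrm
  exact (continuous_norm.continuousAt.inv₀ (norm_ne_zero_iff.2 hx)).smul continuousAt_id

/-- Radial reparametrization. -/
def rad (μ : ℝ ≃o ℝ) (x : Euc n) : Euc n := μ ‖x‖ • nrm x

lemma mu_nonneg {μ : ℝ ≃o ℝ} (h0 : μ 0 = 0) {r : ℝ} (hr : 0 ≤ r) : 0 ≤ μ r := by
  rw [← h0]; exact μ.monotone hr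

lemma norm_rad {μ : ℝ ≃o ℝ} (h0 : μ 0 = 0) (x : Euc n) : ‖rad μ x‖ = μ ‖x‖ := by
  by_cases hx : x = 0
  · simp [rad, hx, h0]
  · rw [rad, norm_smul, norm_nrm hx, mul_one, Real.norm_of_nonneg (mu_nonneg h0 (norm_nonneg _))]

lemma rad_eq_self {μ : ℝ ≃o ℝ} (h1 : μ 1 = 1) {x : Euc n} (hx : ‖x‖ = 1) : rad μ x = x := by
  rw [rad, hx, h1, one_smul, nrm_eq_self hx]

lemma continuous_rad {μ : ℝ ≃o ℝ} (h0 : μ 0 = 0) : Continuous (rad μ : Euc n → Euc n) := by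
  rw [continuous_iff_continuousAt]
  intro x
  by_cases hx : x = 0
  · subst hx
    rw [ContinuousAt, show rad μ (0 : Euc n) = 0 by simp [rad, h0]]
    rw [tendsto_zero_iff_norm_tendsto_zero]
    simp_rw [norm_rad h0]
    have : Continuous fun x : Euc n => μ ‖x‖ := μ.continuous.comp continuous_norm
    have := this.tendsto 0
    rwa [norm_zero, h0] at this
  · exact (μ.continuous.comp continuous_norm).continuousAt.smul (continuousAt_nrm hx)

lemma rad_symm_rad {μ : ℝ ≃o ℝ} (h0 : μ 0 = 0) (x : Euc n) : rad μ.symm (rad μ x) = x := by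
  by_cases hx : x = 0
  · have : μ.symm 0 = 0 := by rw [← h0, μ.symm_apply_apply, h0]
    simp [rad, hx, h0, this]
  · have hp : 0 < μ ‖x‖ := by
      rw [← h0]; exact μ.strictMono (norm_pos_iff.2 hx)
    rw [rad, norm_rad h0, μ.symm_apply_apply, rad, nrm_smul hp, nrm_nrm, norm_smul_nrm]

variable {S : Type*} [MetricSpace S] [CompactSpace S]

/-- `h` restricted to the closed unit ball is an embedding, with open ball mapped to an
open set. -/
structure CellMap (h : Euc n → S) : Prop where
  cont : ContinuousOn h (closedBall 0 1)
  inj : InjOn h (closedBall 0 1)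
  open_ball : IsOpen (h '' ball 0 1)

/-- Partial inverse. -/
def kk (h : Euc n → S) : S → Euc n := Function.invFunOn h (closedBall 0 1)

variable {h : Euc n → S}

lemma CellMap.kk_apply (H : CellMap h) {x : Euc n} (hx : ‖x‖ ≤ 1) : kk h (h x) = x :=
  H.inj.leftInvOn_invFunOn (mem_closedBall_zero_iff.2 hx)

lemma CellMap.kk_cont (H : CellMap h) : ContinuousOn (kk h) (h '' closedBall 0 1) := by
  rw [continuousOn_iff_isClosed]
  intro t ht
  refine ⟨h '' (closedBall 0 1 ∩ t), ?_, ?_⟩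
  · exact (((isCompact_closedBall (0 : Euc n) 1).inter_right ht).image_of_continuousOn
      (H.cont.mono inter_subset_left)).isClosed
  · ext y
    constructor
    · rintro ⟨hy, ⟨z, hz, rfl⟩⟩
      rw [mem_preimage, H.kk_apply (mem_closedBall_zero_iff.1 hz)] at hy
      exact ⟨⟨z, ⟨hz, hy⟩, rfl⟩, ⟨z, hz, rfl⟩⟩
    · rintro ⟨⟨z, hz, rfl⟩, hy⟩
      refine ⟨?_, hy⟩
      rw [mem_preimage, H.kk_apply (mem_closedBall_zero_iff.1 hz.1)]; exact hz.2

lemma CellMap.closed (H : CellMap h) : IsClosed (h '' closedBall 0 1) :=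
  ((isCompact_closedBall (0 : Euc n) 1).image_of_continuousOn H.cont).isClosed

lemma CellMap.cases (H : CellMap h) (y : S) : (∃ x, ‖x‖ < 1 ∧ y = h x) ∨ y ∉ h '' ball 0 1 := by
  by_cases hy : y ∈ h '' ball 0 1
  · obtain ⟨x, hx, rfl⟩ := hy
    exact Or.inl ⟨x, mem_ball_zero_iff.1 hx, rfl⟩
  · exact Or.inr hy

lemma CellMap.norm_eq_one (H : CellMap h) {x : Euc n} (hx : ‖x‖ ≤ 1)
    (hb : h x ∉ h '' ball 0 1) : ‖x‖ = 1 := by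
  by_contra hne
  exact hb ⟨x, mem_ball_zero_iff.2 (lt_of_le_of_ne hx hne), rfl⟩

open Classical in
/-- Transport a self map of the ball to `S`, extended by the identity. -/
def lift (h : Euc n → S) (R : Euc n → Euc n) (y : S) : S :=
  if y ∈ h '' closedBall 0 1 then h (R (kk h y)) else y

lemma CellMap.lift_apply (H : CellMap h) (R : Euc n → Euc n) {x : Euc n} (hx : ‖x‖ ≤ 1) :
    lift h R (h x) = h (R x) := by
  rw [lift, if_pos ⟨x, mem_closedBall_zero_iff.2 hx, rfl⟩, H.kk_apply hx]

lemma CellMap.lift_out (H : CellMap h) {R : Euc n → Euc n} (hR : ∀ x, ‖x‖ = 1 → R x = x)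
    {y : S} (hy : y ∉ h '' ball 0 1) : lift h R y = y := by
  by_cases hy' : y ∈ h '' closedBall 0 1
  · obtain ⟨x, hx, rfl⟩ := hy'
    rw [mem_closedBall_zero_iff] at hx
    rw [H.lift_apply R hx, hR x (H.norm_eq_one hx hy)]
  · rw [lift, if_neg hy']

lemma CellMap.lift_cont (H : CellMap h) {R : Euc n → Euc n} (hR : ∀ x, ‖x‖ = 1 → R x = x)
    (hRb : ∀ x, ‖x‖ ≤ 1 → ‖R x‖ ≤ 1) {A : Set (Euc n)} (hRc : ContinuousOn R A)
    {B : Set S} (hBA : ∀ x, ‖x‖ ≤ 1 → h x ∈ B → x ∈ A) : ContinuousOn (lift h R) B := by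
  have h1 : ContinuousOn (lift h R) (B ∩ h '' closedBall 0 1) := by
    have : ContinuousOn (fun y => h (R (kk h y))) (B ∩ h '' closedBall 0 1) := by
      refine H.cont.comp (hRc.comp (H.kk_cont.mono inter_subset_right) ?_) ?_
      · rintro _ ⟨hB, ⟨x, hx, rfl⟩⟩
        rw [mem_closedBall_zero_iff] at hx
        rw [H.kk_apply hx]
        exact hBA x hx hB
      · rintro _ ⟨hB, ⟨x, hx, rfl⟩⟩
        rw [mem_closedBall_zero_iff] at hx ⊢
        simp only [H.kk_apply hx]
        exact hRb x hx
    refine this.congr ?_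
    rintro _ ⟨hB, hy⟩
    rw [lift, if_pos hy]
  have h2 : ContinuousOn (lift h R) (h '' ball 0 1)ᶜ :=
    continuousOn_id.congr fun y hy => H.lift_out hR hy
  intro y hyB
  by_cases hy : y ∈ h '' ball 0 1
  · have := h1 y ⟨hyB, image_mono ball_subset_closedBall hy⟩
    refine this.mono_of_mem_nhdsWithin ?_
    exact inter_mem self_mem_nhdsWithin (mem_nhdsWithin_of_mem_nhds
      (mem_of_superset (H.open_ball.mem_nhds hy) (image_mono ball_subset_closedBall)))
  · have h2' := h2 y hy
    by_cases hyc : y ∈ h '' closedBall 0 1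
    · have h1' := h1 y ⟨hyB, hyc⟩
      refine (h1'.union h2').mono ?_
      intro z hz
      by_cases hzb : z ∈ h '' ball 0 1
      · exact Or.inl ⟨hz, image_mono ball_subset_closedBall hzb⟩
      · exact Or.inr hzb
    · refine (h2'.mono_of_mem_nhdsWithin (t := (h '' ball 0 1)ᶜ) ?_)
      refine mem_nhdsWithin_of_mem_nhds (mem_of_superset (H.closed.isOpen_compl.mem_nhds hyc) ?_)
      exact compl_subset_compl.2 (image_mono ball_subset_closedBall)

lemma symm_zero {μ : ℝ ≃o ℝ} (h0 : μ 0 = 0) : μ.symm 0 = 0 := by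
  rw [← h0, μ.symm_apply_apply, h0]

lemma symm_one {μ : ℝ ≃o ℝ} (h0 : μ 1 = 1) : μ.symm 1 = 1 := by
  rw [← h0, μ.symm_apply_apply, h0]

lemma norm_rad_le {μ : ℝ ≃o ℝ} (h0 : μ 0 = 0) (h1 : μ 1 = 1) {x : Euc n} (hx : ‖x‖ ≤ 1) :
    ‖rad μ x‖ ≤ 1 := by
  rw [norm_rad h0, ← h1]; exact μ.monotone hx

lemma CellMap.lift_rad_cont (H : CellMap h) {μ : ℝ ≃o ℝ} (h0 : μ 0 = 0) (h1 : μ 1 = 1) :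
    Continuous (lift h (rad μ)) := by
  rw [← continuousOn_univ]
  exact H.lift_cont (fun x hx => rad_eq_self h1 hx) (fun x hx => norm_rad_le h0 h1 hx)
    (A := univ) (continuous_rad h0).continuousOn (fun _ _ _ => mem_univ _)

lemma CellMap.lift_rad_inv (H : CellMap h) {μ : ℝ ≃o ℝ} (h0 : μ 0 = 0) (h1 : μ 1 = 1) (y : S) :
    lift h (rad μ.symm) (lift h (rad μ) y) = y := by
  rcases H.cases y with ⟨x, hx, rfl⟩ | hy
  · rw [H.lift_apply _ hx.le, H.lift_apply _ (norm_rad_le h0 h1 hx.le), rad_symm_rad h0]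
  · rw [H.lift_out (fun x hx => rad_eq_self h1 hx) hy,
      H.lift_out (fun x hx => rad_eq_self (symm_one h1) hx) hy]

/-- The radial homeomorphism of `S`. -/
lemma CellMap.exists_radial (H : CellMap h) {μ : ℝ ≃o ℝ} (h0 : μ 0 = 0) (h1 : μ 1 = 1) :
    ∃ Φ : S ≃ₜ S, (∀ x, ‖x‖ ≤ 1 → Φ (h x) = h (rad μ x)) ∧
      (∀ x, ‖x‖ ≤ 1 → Φ.symm (h x) = h (rad μ.symm x)) ∧
      ∀ y, y ∉ h '' ball 0 1 → Φ y = y ∧ Φ.symm y = y := by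
  refine ⟨⟨⟨lift h (rad μ), lift h (rad μ.symm), H.lift_rad_inv h0 h1, ?_⟩,
    H.lift_rad_cont h0 h1, H.lift_rad_cont (symm_zero h0) (symm_one h1)⟩, ?_, ?_, ?_⟩
  · exact H.lift_rad_inv (μ := μ.symm) (symm_zero h0) (symm_one h1)
  · exact fun x hx => H.lift_apply _ hx
  · exact fun x hx => H.lift_apply _ hx
  · exact fun y hy => ⟨H.lift_out (fun x hx => rad_eq_self h1 hx) hy,
      H.lift_out (fun x hx => rad_eq_self (symm_one h1) hx) hy⟩

/-- The retraction off the center. -/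
lemma CellMap.retr_cont (H : CellMap h) : ContinuousOn (lift h nrm) {h 0}ᶜ := by
  refine H.lift_cont (fun x hx => nrm_eq_self hx) (fun x _ => norm_nrm_le x) (A := {0}ᶜ) ?_ ?_
  · exact fun x hx => (continuousAt_nrm hx).continuousWithinAt
  · intro x hx hxB hx0
    rw [mem_singleton_iff] at hx0
    rw [hx0] at hxB
    exact hxB rfl

lemma CellMap.rad_bound (H : CellMap h) {A : Set S} (hA : IsCompact A) (hAb : A ⊆ h '' ball 0 1) :
    ∃ r < 1, ∀ x, ‖x‖ ≤ 1 → h x ∈ A → ‖x‖ ≤ r := by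
  rcases A.eq_empty_or_nonempty with he | hne
  · exact ⟨0, one_pos, fun x _ hx => by rw [he] at hx; exact hx.elim⟩
  · have hsub : A ⊆ h '' closedBall 0 1 := hAb.trans (image_mono ball_subset_closedBall)
    obtain ⟨a, ha, hmax⟩ := hA.exists_isMaxOn hne (H.kk_cont.mono hsub).norm
    obtain ⟨x0, hx0, rfl⟩ := hAb ha
    rw [mem_ball_zero_iff] at hx0
    refine ⟨‖x0‖, hx0, fun x hx hxA => ?_⟩
    have := hmax hxA
    simpa only [mem_ofPred_eq, H.kk_apply hx, H.kk_apply hx0.le] using this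

end Shrink

namespace Shrink

def ramp (r : ℕ → ℝ) (i : ℕ) (x : ℝ) : ℝ := max 0 (min 1 ((x - r i) / (r (i+1) - r i)))

lemma ramp_nonneg (r : ℕ → ℝ) (i : ℕ) (x : ℝ) : 0 ≤ ramp r i x := le_max_left _ _
lemma ramp_le_one (r : ℕ → ℝ) (i : ℕ) (x : ℝ) : ramp r i x ≤ 1 := by
  simp [ramp]
lemma ramp_zero {r : ℕ → ℝ} (hr : StrictMono r) {i : ℕ} {x : ℝ} (hx : x ≤ r i) :
    ramp r i x = 0 := by
  have h : 0 < r (i+1) - r i := sub_pos.2 (hr (Nat.lt_succ_self i))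
  have : (x - r i) / (r (i+1) - r i) ≤ 0 := div_nonpos_of_nonpos_of_nonneg (by linarith) h.le
  exact max_eq_left ((min_le_right _ _).trans this)
lemma ramp_one {r : ℕ → ℝ} (hr : StrictMono r) {i : ℕ} {x : ℝ} (hx : r (i+1) ≤ x) :
    ramp r i x = 1 := by
  have h : 0 < r (i+1) - r i := sub_pos.2 (hr (Nat.lt_succ_self i))
  have : 1 ≤ (x - r i) / (r (i+1) - r i) := by rw [le_div_iff₀ h]; linarith
  simp [ramp, min_eq_left this]
lemma ramp_mono {r : ℕ → ℝ} (hr : StrictMono r) (i : ℕ) : Monotone (ramp r i) := by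
  intro x y hxy
  have h : 0 < r (i+1) - r i := sub_pos.2 (hr (Nat.lt_succ_self i))
  unfold ramp
  gcongr
lemma ramp_cont (r : ℕ → ℝ) (i : ℕ) : Continuous (ramp r i) := by
  unfold ramp
  fun_prop

def rsum (r : ℕ → ℝ) (M : ℕ) (x : ℝ) : ℝ := ∑ i ∈ Finset.range M, ramp r i x

lemma rsum_le (r : ℕ → ℝ) (M : ℕ) (x : ℝ) : rsum r M x ≤ M := by
  calc rsum r M x ≤ ∑ i ∈ Finset.range M, (1:ℝ) := Finset.sum_le_sum fun i _ => ramp_le_one r i x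
    _ = M := by simp

lemma rsum_le_k {r : ℕ → ℝ} (hr : StrictMono r) (M : ℕ) {k : ℕ} {x : ℝ} (hx : x ≤ r k) :
    rsum r M x ≤ k := by
  induction M with
  | zero => simp [rsum]
  | succ m ih =>
    by_cases hm : m < k
    · refine (rsum_le r _ x).trans ?_
      exact_mod_cast hm
    · have : rsum r (m+1) x = rsum r m x + ramp r m x := Finset.sum_range_succ _ _
      rw [this, ramp_zero hr (hx.trans (hr.monotone (not_lt.1 hm)))]
      simpa using ih

lemma rsum_ge_k {r : ℕ → ℝ} (hr : StrictMono r) {M : ℕ} {k : ℕ} (hk : k ≤ M) {x : ℝ} (hx : r k ≤ x) :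
    (k:ℝ) ≤ rsum r M x := by
  calc (k:ℝ) = ∑ i ∈ Finset.range k, ramp r i x := by
        rw [Finset.sum_congr rfl (g := fun _ => (1:ℝ))]
        · simp
        · intro i hi
          exact ramp_one hr ((hr.monotone (Nat.succ_le_of_lt (Finset.mem_range.1 hi))).trans hx)
    _ ≤ _ := Finset.sum_le_sum_of_subset_of_nonneg (Finset.range_mono hk) fun i _ _ => ramp_nonneg r i x

theorem exists_reparam (Q : ℝ → ℝ → Prop)
    (hQ : ∀ r < 1, ∃ r' < 1, ∀ a b, Q a b → a ≤ r → b ≤ r')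
    {σ κ rs : ℝ} (hσ : 0 < σ) (hσ1 : σ < 1) (hκ : 0 < κ) (hrs : rs < 1) :
    ∃ r0, rs < r0 ∧ 1/2 < r0 ∧ r0 < 1 ∧ ∃ μ : ℝ ≃o ℝ, μ 0 = 0 ∧ μ 1 = 1 ∧ μ r0 ≤ σ ∧ σ/2 ≤ μ r0 ∧
      (∀ a b, Q a b → a ≤ r0 → μ b ≤ σ + κ) ∧
      (∀ a b, Q a b → r0 ≤ a → a ≤ b → b < 1 → μ b - μ a ≤ κ) := by
  have hT : ∀ r : ℝ, ∃ t, r < 1 → r < t ∧ t < 1 ∧ ∀ a b, Q a b → a ≤ r → b ≤ t := by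
    intro r
    by_cases h : r < 1
    · obtain ⟨t, ht, hh⟩ := hQ r h
      refine ⟨max t ((r+1)/2), fun _ => ⟨?_, ?_, ?_⟩⟩
      · exact lt_max_of_lt_right (by linarith)
      · exact max_lt ht (by linarith)
      · intro a b hab ha
        exact (hh a b hab ha).trans (le_max_left _ _)
    · exact ⟨0, fun h' => absurd h' h⟩
  choose T hT using hT
  obtain ⟨r0, hr0, hr1⟩ : ∃ r0, max (max rs (1/2)) (1 - κ/2) < r0 ∧ r0 < 1 :=
    exists_between (max_lt (max_lt hrs (by norm_num)) (by linarith))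
  rw [max_lt_iff, max_lt_iff] at hr0
  obtain ⟨⟨hr0a, hr0b⟩, hr0c⟩ := hr0
  let r : ℕ → ℝ := fun i => T^[i] r0
  have rs_succ : ∀ i, r (i+1) = T (r i) := fun i => Function.iterate_succ_apply' T i r0
  have r_lt : ∀ i, r i < 1 := by
    intro i
    induction i with
    | zero => exact hr1
    | succ i ih => rw [rs_succ]; exact (hT _ ih).2.1
  have r_mono : StrictMono r := strictMono_nat_of_lt_succ fun i => by
    rw [rs_succ]; exact (hT _ (r_lt i)).1
  have r_zero : r 0 = r0 := rfl
  have r_pos : ∀ i, 1/2 < r i := fun i => lt_of_lt_of_le (by rw [r_zero]; exact hr0b) (r_mono.monotone (Nat.zero_le i))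
  obtain ⟨M, hM⟩ := exists_nat_gt (4/κ)
  have hM0 : (0:ℝ) < M := lt_trans (by positivity) hM
  have hMκ : 2 / (M:ℝ) ≤ κ/2 := by
    rw [div_le_iff₀ hM0]; rw [div_lt_iff₀ hκ] at hM; linarith
  let f : ℝ → ℝ := fun x => (1-σ) * (rsum r M x / M) + σ * x
  have hf_sm : StrictMono f := by
    intro x y hxy
    have h1 : rsum r M x ≤ rsum r M y := Finset.sum_le_sum fun i _ => ramp_mono r_mono i hxy.le
    have h2 : rsum r M x / M ≤ rsum r M y / M := by gcongr
    have h3 := mul_le_mul_of_nonneg_left h2 (by linarith : 0 ≤ 1 - σ)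
    have h4 := mul_lt_mul_of_pos_left hxy hσ
    show (1-σ) * (rsum r M x / M) + σ * x < (1-σ) * (rsum r M y / M) + σ * y
    linarith
  have hf_c : Continuous f := by
    have : Continuous (rsum r M) := by
      unfold rsum
      exact continuous_finsetSum _ fun i _ => ramp_cont r i
    fun_prop
  have hnn : ∀ x, 0 ≤ rsum r M x / M := fun x =>
    div_nonneg (Finset.sum_nonneg fun i _ => ramp_nonneg r i x) hM0.le
  have hle1 : ∀ x, rsum r M x / M ≤ 1 := fun x => by
    rw [div_le_one hM0]; exact rsum_le r M x
  have hf_surj : Function.Surjective f := by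
    apply hf_c.surjective
    · refine tendsto_atTop_mono (f := fun x => σ * x) ?_ (tendsto_id.const_mul_atTop hσ)
      intro x
      have := mul_nonneg (by linarith : 0 ≤ 1 - σ) (hnn x)
      show σ * x ≤ (1-σ) * (rsum r M x / M) + σ * x
      linarith
    · refine tendsto_atBot_mono (g := f) (f := fun x => 1 + σ * x) ?_ (tendsto_atBot_add_const_left _ _ (tendsto_id.const_mul_atBot hσ))
      intro x
      have h1 := hle1 x
      have h2 := hnn x
      show (1-σ) * (rsum r M x / M) + σ * x ≤ 1 + σ * x
      nlinarith
  have fz : ∀ x ≤ r0, f x = σ * x := by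
    intro x hx
    have : rsum r M x = 0 := Finset.sum_eq_zero fun i _ =>
      ramp_zero r_mono (hx.trans (r_mono.monotone (Nat.zero_le i)))
    simp [f, this]
  have key : ∀ a b (c : ℝ), rsum r M b - rsum r M a ≤ c → 0 ≤ c → 
      (1-σ) * (rsum r M b / M) - (1-σ) * (rsum r M a / M) ≤ c / M := by
    intro a b c hc hc0
    have h1 : (1-σ) * (rsum r M b / M) - (1-σ) * (rsum r M a / M) = (1-σ) * ((rsum r M b - rsum r M a) / M) := by ring
    rw [h1]
    have h2 : (rsum r M b - rsum r M a) / M ≤ c / M := by gcongr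
    have h3 := mul_le_mul_of_nonneg_left h2 (by linarith : 0 ≤ 1 - σ)
    have h4 : 0 ≤ c / M := by positivity
    nlinarith
  refine ⟨r0, hr0a, hr0b, hr1, hf_sm.orderIsoOfSurjective f hf_surj, ?_, ?_, ?_, ?_, ?_, ?_⟩
  · show f 0 = 0
    rw [fz 0 (by linarith)]; simp
  · show f 1 = 1
    have : rsum r M 1 = M := le_antisymm (rsum_le _ _ _) (rsum_ge_k r_mono le_rfl (r_lt M).le)
    simp [f, this, hM0.ne']
  · show f r0 ≤ σ
    rw [fz r0 le_rfl]; nlinarith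
  · show σ/2 ≤ f r0
    rw [fz r0 le_rfl]; nlinarith
  · intro a b hab ha
    show f b ≤ σ + κ
    have hb : b ≤ r 1 := by rw [rs_succ]; exact (hT _ (r_lt 0)).2.2 a b hab ha
    have h1 : rsum r M b ≤ (1:ℕ) := rsum_le_k r_mono M hb
    have h0 : rsum r M 0 = 0 := Finset.sum_eq_zero fun i _ =>
      ramp_zero r_mono (by linarith [r_pos i])
    have h2 := key 0 b 1 (by rw [h0]; simpa using h1) zero_le_one
    rw [h0] at h2
    have h3 : b < 1 := hb.trans_lt (r_lt 1)
    have h4 : (1:ℝ)/M ≤ 2/M := by gcongr; norm_num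
    show (1-σ) * (rsum r M b / M) + σ * b ≤ σ + κ
    simp at h2
    simp at h4
    nlinarith
  · intro a b hab ha hle hb
    show f b - f a ≤ κ
    have h5 : σ * b - σ * a ≤ κ/2 := by nlinarith
    have h6 : rsum r M b - rsum r M a ≤ 2 := by
      by_cases haM : r M ≤ a
      · have := rsum_ge_k r_mono le_rfl haM
        linarith [rsum_le r M b]
      · have hex : ∃ i, a < r i := ⟨M, not_le.1 haM⟩
        classical
        let k := Nat.find hex
        have hk : a < r k := Nat.find_spec hex
        have hkM : k ≤ M := Nat.find_min' hex (not_le.1 haM)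
        have hk0 : k ≠ 0 := by
          intro h
          rw [h] at hk
          exact absurd hk (not_lt.2 ha)
        obtain ⟨i, hi⟩ := Nat.exists_eq_succ_of_ne_zero hk0
        have hi' : r i ≤ a := not_lt.1 (Nat.find_min hex (by show i < k; omega))
        have hb2 : b ≤ r (k+1) := by
          rw [rs_succ]; exact (hT _ (r_lt k)).2.2 a b hab hk.le
        have e1 := rsum_le_k r_mono M hb2
        have e2 := rsum_ge_k r_mono (by omega : i ≤ M) hi'
        rw [hi] at e1
        push_cast at e1
        linarith
    have h7 := key a b 2 h6 (by norm_num)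
    show ((1-σ) * (rsum r M b / M) + σ * b) - ((1-σ) * (rsum r M a / M) + σ * a) ≤ κ
    linarith

end Shrink

namespace Shrink
variable {n : ℕ} {S : Type*} [MetricSpace S] [CompactSpace S] {h : Euc n → S}

lemma CellMap.outer_compact (H : CellMap h) {t : ℝ} (ht : t ≤ 1) : IsCompact (h '' ball 0 t)ᶜ := by
  have : (h '' ball 0 t)ᶜ = (h '' ball 0 1)ᶜ ∪ h '' (closedBall 0 1 \ ball 0 t) := by
    ext y
    constructor
    · intro hy
      rcases H.cases y with ⟨x, hx, rfl⟩ | hy'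
      · exact Or.inr ⟨x, ⟨mem_closedBall_zero_iff.2 hx.le, fun hh => hy ⟨x, hh, rfl⟩⟩, rfl⟩
      · exact Or.inl hy'
    · rintro (hy | ⟨x, hx, rfl⟩)
      · exact fun hh => hy (image_mono (ball_subset_ball ht) hh)
      · rintro ⟨x', hx', he⟩
        have : x' = x := H.inj (ball_subset_closedBall (ball_subset_ball ht hx')) hx.1 he
        exact hx.2 (this ▸ hx')
  rw [this]
  refine (H.open_ball.isClosed_compl.isCompact).union ?_
  exact ((isCompact_closedBall (0 : Euc n) 1).diff isOpen_ball).image_of_continuousOn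
    (H.cont.mono diff_subset)

lemma perm_outer {t : ℝ} {ψ : S ≃ₜ S} (hψ : ∀ x, ‖x‖ < t → ψ (h x) = h x) {y : S}
    (hy : y ∉ h '' ball 0 t) : ψ y ∉ h '' ball 0 t := by
  rintro ⟨x, hx, he⟩
  apply hy
  refine ⟨x, hx, ψ.injective ?_⟩
  rw [hψ x (mem_ball_zero_iff.1 hx), he]

lemma dist_rad_nrm {c : ℝ} (hc : c ≤ 1) (x : Euc n) : dist (c • nrm x) (nrm x) ≤ 1 - c := by
  rw [dist_eq_norm]
  have : c • nrm x - nrm x = (c - 1) • nrm x := by module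
  rw [this, norm_smul, Real.norm_eq_abs, abs_of_nonpos (by linarith)]
  nlinarith [norm_nrm_le x, norm_nonneg (nrm x)]

lemma dist_rad_rad {μ : ℝ ≃o ℝ} (h0 : μ 0 = 0) (h1 : μ 1 = 1) {x y : Euc n} (hx : ‖x‖ ≤ 1) :
    dist (rad μ x) (rad μ y) ≤ dist (nrm x) (nrm y) + |μ ‖x‖ - μ ‖y‖| := by
  rw [dist_eq_norm, dist_eq_norm]
  have : rad μ x - rad μ y = μ ‖x‖ • (nrm x - nrm y) + (μ ‖x‖ - μ ‖y‖) • nrm y := by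
    unfold rad; module
  rw [this]
  refine (norm_add_le _ _).trans ?_
  rw [norm_smul, norm_smul, Real.norm_eq_abs, Real.norm_eq_abs]
  have e1 : 0 ≤ μ ‖x‖ := mu_nonneg h0 (norm_nonneg _)
  have e2 : μ ‖x‖ ≤ 1 := by rw [← h1]; exact μ.monotone hx
  rw [abs_of_nonneg e1]
  gcongr
  · nlinarith [norm_nonneg (nrm x - nrm y)]
  · nlinarith [norm_nrm_le y, abs_nonneg (μ ‖x‖ - μ ‖y‖)]

lemma ddiam {A : Set S} {x y : S} (hx : x ∈ A) (hy : y ∈ A) : dist x y ≤ diam A :=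
  dist_le_diam_of_mem isBounded_of_compactSpace hx hy

lemma CellMap.hQ (H : CellMap h) {ι : Type*} {C : ι → Set S} (hC : ∀ j, IsCompact (C j))
    (hCs : ∀ j, C j ⊆ h '' ball 0 1) (hCd : ∀ δ > 0, {j | δ ≤ diam (C j)}.Finite)
    (r : ℝ) (hr : r < 1) : ∃ r' < 1, ∀ j x y, ‖x‖ < 1 → ‖y‖ < 1 → h x ∈ C j → h y ∈ C j →
      ‖x‖ ≤ r → ‖y‖ ≤ r' := by
  have hK : IsCompact (h '' closedBall 0 r) := (isCompact_closedBall (0 : Euc n) r).image_of_continuousOn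
    (H.cont.mono (closedBall_subset_closedBall hr.le))
  have hKs : h '' closedBall 0 r ⊆ h '' ball 0 1 := image_mono (closedBall_subset_ball hr)
  obtain ⟨δ, hδ, hsub⟩ := hK.exists_cthickening_subset_open H.open_ball hKs
  have hA : IsCompact (cthickening δ (h '' closedBall 0 r) ∪ ⋃ j ∈ {j | δ ≤ diam (C j)}, C j) :=
    (isClosed_cthickening.isCompact).union ((hCd δ hδ).isCompact_biUnion fun j _ => hC j)
  obtain ⟨r', hr', hb⟩ := H.rad_bound hA (union_subset hsub (iUnion₂_subset fun j _ => hCs j))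
  refine ⟨r', hr', fun j x y hx hy hxC hyC hxr => hb y hy.le ?_⟩
  by_cases hj : δ ≤ diam (C j)
  · exact Or.inr (mem_biUnion (x := j) hj hyC)
  · left
    exact mem_cthickening_of_dist_le (h y) (h x) δ _ ⟨x, mem_closedBall_zero_iff.2 hxr, rfl⟩
      ((ddiam hyC hxC).trans (not_le.1 hj).le)

theorem shrink_one (H : CellMap h)
    (hψ : ∃ zs ≠ h 0, ∀ N ∈ 𝓝 zs, ∃ ψ : S ≃ₜ S, (∀ᶠ y in 𝓝 (h 0), ψ y = y) ∧
      ∀ y ∉ h '' ball 0 1, ψ y ∈ N)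
    {ι : Type*} {C : ι → Set S} (hC : ∀ j, IsCompact (C j))
    (hCs : ∀ j, C j ⊆ h '' ball 0 1) (hCd : ∀ δ > 0, {j | δ ≤ diam (C j)}.Finite)
    {W : Set S} (hW : IsOpen W) (hWK : (h '' ball 0 1)ᶜ ⊆ W) {ε : ℝ} (hε : 0 < ε) :
    ∃ θ : S ≃ₜ S, (∀ y ∉ W, θ y = y) ∧ diam (θ '' (h '' ball 0 1)ᶜ) < ε ∧
      ∀ j, (∀ y ∈ C j, θ y = y) ∨ diam (θ '' C j) < ε := by
  obtain ⟨zs, hzs, hψ⟩ := hψ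
  set ρ := lift h nrm with hρ
  have hρc : ContinuousAt ρ zs := H.retr_cont.continuousAt (isOpen_compl_singleton.mem_nhds hzs)
  set ε' := ε / 8 with hε'
  have hε'0 : 0 < ε' := by positivity
  obtain ⟨ψ, hψ0, hψK⟩ := hψ {y | dist (ρ y) (ρ zs) < ε'} (hρc (ball_mem_nhds _ hε'0))
  obtain ⟨t, ht0, ht1, htψ⟩ : ∃ t > 0, t < 1 ∧ ∀ x, ‖x‖ ≤ t → ψ (h x) = h x := by
    have hc : ContinuousAt h 0 := H.cont.continuousAt (closedBall_mem_nhds _ one_pos)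
    have := hc.eventually hψ0
    obtain ⟨t0, ht0, hh⟩ := Metric.eventually_nhds_iff_ball.1 this
    refine ⟨min (t0/2) (1/2), by positivity, (min_le_right _ _).trans_lt (by norm_num), fun x hx => hh x ?_⟩
    rw [mem_ball_zero_iff]
    linarith [hx.trans (min_le_left _ _)]
  have hV := H.outer_compact (t := t/4) (by linarith)
  set V := (h '' ball 0 (t/4))ᶜ with hVdef
  have hψV : ∀ y ∈ V, ψ y ∈ V := fun y hy =>
    perm_outer (t := t/4) (fun x hx => htψ x (by linarith)) hy
  have hc1 : ContinuousOn (fun y => ρ (ψ y)) V := by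
    refine H.retr_cont.comp ψ.continuous.continuousOn ?_
    intro y hy he
    rw [mem_singleton_iff] at he
    exact hψV y hy ⟨0, by simp; positivity, he.symm⟩
  obtain ⟨η, hη, hηV⟩ := Metric.uniformContinuousOn_iff.1 (hV.uniformContinuousOn_of_continuous hc1) ε' hε'0
  have hcu := (isCompact_closedBall (0 : Euc n) 1).uniformContinuousOn_of_continuous H.cont
  obtain ⟨κ2, hκ2, hκ2h⟩ := Metric.uniformContinuousOn_iff.1 hcu η hη
  obtain ⟨κ3, hκ3, hκ3h⟩ := Metric.uniformContinuousOn_iff.1 hcu ε' hε'0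
  set κ := min (t/2) (κ2/4) with hκ
  have hκ0 : 0 < κ := by positivity
  have hcomp : IsCompact (h '' (closedBall 0 1 \ ball 0 (1/2))) :=
    ((isCompact_closedBall (0 : Euc n) 1).diff isOpen_ball).image_of_continuousOn
      (H.cont.mono diff_subset)
  have hc2 : ContinuousOn (fun y => nrm (kk h y)) (h '' (closedBall 0 1 \ ball 0 (1/2))) := by
    have hn : ContinuousOn (nrm : Euc n → Euc n) {0}ᶜ := fun x hx => (continuousAt_nrm hx).continuousWithinAt
    refine hn.comp (H.kk_cont.mono (image_mono diff_subset)) ?_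
    rintro _ ⟨x, hx, rfl⟩
    rw [H.kk_apply (mem_closedBall_zero_iff.1 hx.1)]
    rintro h0
    rw [mem_singleton_iff] at h0
    exact hx.2 (by rw [h0]; simp)
  obtain ⟨ν, hν, hνh⟩ := Metric.uniformContinuousOn_iff.1 (hcomp.uniformContinuousOn_of_continuous hc2) (κ2/2) (by positivity)
  have hA : IsCompact (Wᶜ ∪ ⋃ j ∈ {j | ν ≤ diam (C j)}, C j) :=
    (hW.isClosed_compl.isCompact).union ((hCd ν hν).isCompact_biUnion fun j _ => hC j)
  obtain ⟨rs, hrs, hrsA⟩ := H.rad_bound hA (union_subset (by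
    rw [compl_subset_comm]; exact hWK) (iUnion₂_subset fun j _ => hCs j))
  obtain ⟨r0, hr0s, hr0h, hr01, μ, h0, h1, hμ1, hμ2, hμ3, hμ4⟩ := exists_reparam
    (fun a b => ∃ j x y, ‖x‖ < 1 ∧ ‖y‖ < 1 ∧ h x ∈ C j ∧ h y ∈ C j ∧ ‖x‖ = a ∧ ‖y‖ = b) (by
      intro r hr
      obtain ⟨r', hr', hh⟩ := H.hQ hC hCs hCd r hr
      refine ⟨r', hr', ?_⟩
      rintro a b ⟨j, x, y, hx, hy, hxC, hyC, rfl, rfl⟩ hxr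
      exact hh j x y hx hy hxC hyC hxr) (σ := t/2) (κ := κ) (rs := max rs (1 - κ3)) (by positivity) (by linarith) hκ0
      (max_lt hrs (by linarith))
  obtain ⟨hr0s, hr0k⟩ := max_lt_iff.1 hr0s
  obtain ⟨Φ, hΦ, hΦs, hΦo⟩ := H.exists_radial h0 h1
  have κt : κ ≤ t/2 := min_le_left _ _
  have κk : κ ≤ κ2/4 := min_le_right _ _
  have hμr : μ r0 ≤ t/2 := hμ1
  set V' := (h '' ball 0 (μ r0))ᶜ with hV'
  have hV'V : V' ⊆ V := compl_subset_compl.2 (image_mono (ball_subset_ball (by linarith)))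
  have hψV' : ∀ y ∈ V', ψ y ∈ V' := fun y hy =>
    perm_outer (t := μ r0) (fun x hx => htψ x (by linarith)) hy
  have hclose : ∀ y ∈ V', dist (Φ.symm y) (ρ y) ≤ ε' := by
    intro y hy
    rcases H.cases y with ⟨x, hx, rfl⟩ | hy'
    · have hxr : μ r0 ≤ ‖x‖ := by
        by_contra hlt
        exact hy ⟨x, mem_ball_zero_iff.2 (not_le.1 hlt), rfl⟩
      rw [hΦs x hx.le, hρ, H.lift_apply _ hx.le]
      apply le_of_lt
      apply hκ3h _ (mem_closedBall_zero_iff.2 (norm_rad_le (symm_zero h0) (symm_one h1) hx.le)) _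
        (mem_closedBall_zero_iff.2 (norm_nrm_le x))
      have e1 : μ.symm ‖x‖ ≤ 1 := by rw [← symm_one h1]; exact μ.symm.monotone hx.le
      have e2 : r0 ≤ μ.symm ‖x‖ := by rw [← μ.symm_apply_apply r0]; exact μ.symm.monotone hxr
      exact (dist_rad_nrm e1 x).trans_lt (by linarith)
    · rw [(hΦo y hy').2, hρ, H.lift_out (fun x hx => nrm_eq_self hx) hy', dist_self]
      exact hε'0.le
  have hsmall : ∀ x, ‖x‖ ≤ 1 → μ ‖x‖ ≤ t → Φ.symm (ψ (Φ (h x))) = h x := by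
    intro x hx hxt
    rw [hΦ x hx, htψ _ (by rw [norm_rad h0]; exact hxt), ← hΦ x hx, Φ.symm_apply_apply]
  refine ⟨(Φ.trans ψ).trans Φ.symm, ?_, ?_, ?_⟩
  · intro y hy
    rcases H.cases y with ⟨x, hx, rfl⟩ | hy'
    · have : ‖x‖ ≤ rs := hrsA x hx.le (Or.inl hy)
      have h2 : μ ‖x‖ ≤ μ r0 := μ.monotone (by linarith)
      exact hsmall x hx.le (by linarith)
    · exact absurd (hWK hy') hy
  · refine lt_of_le_of_lt (diam_le_of_forall_dist_le (C := 4 * ε') (by positivity) ?_) (by rw [hε']; linarith)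
    have hb : ∀ y ∉ h '' ball 0 1, dist (Φ.symm (ψ (Φ y))) (ρ zs) ≤ 2 * ε' := by
      intro y hy
      rw [(hΦo y hy).1]
      have hyV : y ∈ V' := fun hh => hy (image_mono (ball_subset_ball (by linarith)) hh)
      have e1 := hclose _ (hψV' y hyV)
      have e2 : dist (ρ (ψ y)) (ρ zs) < ε' := hψK y hy
      linarith [dist_triangle (Φ.symm (ψ y)) (ρ (ψ y)) (ρ zs)]
    rintro _ ⟨y, hy, rfl⟩ _ ⟨z, hz, rfl⟩
    have e1 := hb y hy
    have e2 := hb z hz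
    have e3 := dist_triangle_right (Φ.symm (ψ (Φ y))) (Φ.symm (ψ (Φ z))) (ρ zs)
    show dist (Φ.symm (ψ (Φ y))) (Φ.symm (ψ (Φ z))) ≤ 4 * ε'
    linarith
  · intro j
    by_cases hj : ∃ x, ‖x‖ < 1 ∧ h x ∈ C j ∧ ‖x‖ ≤ r0
    · left
      obtain ⟨x, hx, hxC, hxr⟩ := hj
      intro y hy
      obtain ⟨w, hw, rfl⟩ := hCs j hy
      rw [mem_ball_zero_iff] at hw
      have := hμ3 ‖x‖ ‖w‖ ⟨j, x, w, hx, hw, hxC, hy, rfl, rfl⟩ hxr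
      exact hsmall w hw.le (by linarith)
    · right
      push Not at hj
      refine lt_of_le_of_lt (diam_le_of_forall_dist_le (C := 3 * ε') (by positivity) ?_) (by rw [hε']; linarith)
      have main : ∀ x y, ‖x‖ < 1 → ‖y‖ < 1 → h x ∈ C j → h y ∈ C j → ‖x‖ ≤ ‖y‖ →
          dist (Φ.symm (ψ (Φ (h x)))) (Φ.symm (ψ (Φ (h y)))) ≤ 3 * ε' := by
        intro x y hx hy hxC hyC hxy
        have hxr := hj x hx hxC
        have hyr := hj y hy hyC
        have hdj : diam (C j) < ν := by
          by_contra hge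
          have := hrsA x hx.le (Or.inr (mem_biUnion (x := j) (not_lt.1 hge) hxC))
          linarith
        have inV : ∀ w, ‖w‖ < 1 → r0 < ‖w‖ → Φ (h w) ∈ V' := by
          intro w hw hwr
          rw [hΦ w hw.le]
          rintro ⟨u, hu, he⟩
          rw [mem_ball_zero_iff] at hu
          have : u = rad μ w := H.inj (mem_closedBall_zero_iff.2 (by linarith))
            (mem_closedBall_zero_iff.2 (norm_rad_le h0 h1 hw.le)) he
          rw [this, norm_rad h0] at hu
          exact absurd (μ.lt_iff_lt.1 hu) (by linarith)
        have hin : ∀ w, ‖w‖ < 1 → r0 < ‖w‖ → h w ∈ h '' (closedBall 0 1 \ ball 0 (1/2)) := by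
          intro w hw hwr
          exact ⟨w, ⟨mem_closedBall_zero_iff.2 hw.le, fun hh => by
            rw [mem_ball_zero_iff] at hh; linarith⟩, rfl⟩
        have e1 := hνh _ (hin x hx hxr) _ (hin y hy hyr) ((ddiam hxC hyC).trans_lt hdj)
        simp only [H.kk_apply hx.le, H.kk_apply hy.le] at e1
        have e2 := hμ4 ‖x‖ ‖y‖ ⟨j, x, y, hx, hy, hxC, hyC, rfl, rfl⟩ hxr.le hxy hy
        have e3 : |μ ‖x‖ - μ ‖y‖| ≤ κ := by
          rw [abs_of_nonpos (sub_nonpos.2 (μ.monotone hxy))]; linarith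
        have e4 := dist_rad_rad (y := y) h0 h1 hx.le
        have e5 : dist (Φ (h x)) (Φ (h y)) < η := by
          rw [hΦ x hx.le, hΦ y hy.le]
          exact hκ2h _ (mem_closedBall_zero_iff.2 (norm_rad_le h0 h1 hx.le)) _
            (mem_closedBall_zero_iff.2 (norm_rad_le h0 h1 hy.le)) (by linarith)
        have e6 := hηV _ (hV'V (inV x hx hxr)) _ (hV'V (inV y hy hyr)) e5
        have e7 := hclose _ (hψV' _ (inV x hx hxr))
        have e8 := hclose _ (hψV' _ (inV y hy hyr))
        have e9 := dist_triangle4_right (Φ.symm (ψ (Φ (h x)))) (Φ.symm (ψ (Φ (h y)))) (ρ (ψ (Φ (h x)))) (ρ (ψ (Φ (h y))))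
        linarith
      rintro _ ⟨a, ha, rfl⟩ _ ⟨b, hb, rfl⟩
      obtain ⟨x, hx, rfl⟩ := hCs j ha
      obtain ⟨y, hy, rfl⟩ := hCs j hb
      rw [mem_ball_zero_iff] at hx hy
      rcases le_total ‖x‖ ‖y‖ with hle | hle
      · exact main x y hx hy ha hb hle
      · rw [dist_comm]; exact main y x hy hx hb ha hle

end Shrink

namespace Shrink

section quot
variable {S Y : Type*} [MetricSpace S] [CompactSpace S] [TopologicalSpace Y] {π : S → Y}

lemma t2_of_closed (hc : Continuous π) (hcl : IsClosedMap π) (hs : Function.Surjective π) :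
    T2Space Y := by
  have hone : ∀ y : Y, IsClosed ({y} : Set Y) := by
    intro y
    obtain ⟨x, rfl⟩ := hs y
    simpa using hcl {x} isClosed_singleton
  refine ⟨fun y z hyz => ?_⟩
  have hd : Disjoint (π ⁻¹' {y}) (π ⁻¹' {z}) := by
    rw [Set.disjoint_left]
    rintro x hx hx'
    exact hyz (hx.symm.trans hx')
  obtain ⟨O1, O2, h1, h2, hy, hz, hO⟩ := SeparatedNhds.of_isCompact_isCompact
    ((hone y).preimage hc).isCompact ((hone z).preimage hc).isCompact hd
  refine ⟨(π '' O1ᶜ)ᶜ, (π '' O2ᶜ)ᶜ, (hcl _ h1.isClosed_compl).isOpen_compl,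
    (hcl _ h2.isClosed_compl).isOpen_compl, ?_, ?_, ?_⟩
  · rintro ⟨x, hx, he⟩
    exact hx (hy he)
  · rintro ⟨x, hx, he⟩
    exact hx (hz he)
  · rw [Set.disjoint_left]
    intro w hw hw'
    obtain ⟨x, rfl⟩ := hs w
    have e1 : x ∈ O1 := by by_contra h; exact hw ⟨x, h, rfl⟩
    have e2 : x ∈ O2 := by by_contra h; exact hw' ⟨x, h, rfl⟩
    exact Set.disjoint_left.1 hO e1 e2

lemma sc_of_closed (hc : Continuous π) (hcl : IsClosedMap π) (hs : Function.Surjective π) :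
    SecondCountableTopology Y := by
  have hone : ∀ y : Y, IsClosed ({y} : Set Y) := by
    intro y
    obtain ⟨x, rfl⟩ := hs y
    simpa using hcl {x} isClosed_singleton
  let b := TopologicalSpace.countableBasis S
  have hb := TopologicalSpace.isBasis_countableBasis S
  let B : Set (Set Y) := (fun T : Set (Set S) => (π '' (⋃₀ T)ᶜ)ᶜ) '' {T | T.Finite ∧ T ⊆ b}
  have hB : TopologicalSpace.IsTopologicalBasis B := by
    apply TopologicalSpace.isTopologicalBasis_of_isOpen_of_nhds
    · rintro _ ⟨T, hT, rfl⟩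
      have : IsOpen (⋃₀ T) := isOpen_sUnion fun t ht => hb.isOpen (hT.2 ht)
      exact (hcl _ this.isClosed_compl).isOpen_compl
    · intro y U hy hU
      have hcomp : IsCompact (π ⁻¹' {y}) := ((hone y).preimage hc).isCompact
      have hUo : IsOpen (π ⁻¹' U) := hU.preimage hc
      let T0 : Set (Set S) := {t ∈ b | t ⊆ π ⁻¹' U}
      have hcov : π ⁻¹' {y} ⊆ ⋃₀ T0 := by
        intro x hx
        have : x ∈ π ⁻¹' U := by
          rw [mem_preimage, mem_singleton_iff] at hx
          rw [mem_preimage, hx]; exact hy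
        obtain ⟨t, htb, hxt, hts⟩ := hb.exists_subset_of_mem_open this hUo
        exact ⟨t, ⟨htb, hts⟩, hxt⟩
      obtain ⟨T, hT, hTf, hTc⟩ := hcomp.elim_finite_subcover_image (b := T0) (c := id) (fun t ht => hb.isOpen ht.1)
        (by rw [sUnion_eq_biUnion] at hcov; exact hcov)
      have hTc : π ⁻¹' {y} ⊆ ⋃₀ T := by rw [sUnion_eq_biUnion]; exact hTc
      refine ⟨_, ⟨T, ⟨hTf, fun t ht => (hT ht).1⟩, rfl⟩, ?_, ?_⟩
      · rintro ⟨x, hx, he⟩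
        exact hx (hTc he)
      · intro w hw
        obtain ⟨x, rfl⟩ := hs w
        have : x ∈ ⋃₀ T := by by_contra h; exact hw ⟨x, h, rfl⟩
        obtain ⟨t, ht, hxt⟩ := this
        exact (hT ht).2 hxt
  refine hB.secondCountableTopology (Countable.image ?_ _)
  exact Set.countable_ofPred_finite_subset (TopologicalSpace.countable_countableBasis S)

end quot

universe u
variable {S : Type u} [MetricSpace S] [CompactSpace S] {ι : Type*} {K : ι → Set S}

def decSetoid (K : ι → Set S) (hd : ∀ i j x, x ∈ K i → x ∈ K j → i = j) : Setoid S where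
  r x y := x = y ∨ ∃ j, x ∈ K j ∧ y ∈ K j
  iseqv := ⟨fun x => Or.inl rfl, by
    rintro x y (rfl | ⟨j, h1, h2⟩)
    · exact Or.inl rfl
    · exact Or.inr ⟨j, h2, h1⟩, by
    rintro x y z (rfl | ⟨j, h1, h2⟩) (rfl | ⟨i, h3, h4⟩)
    · exact Or.inl rfl
    · exact Or.inr ⟨i, h3, h4⟩
    · exact Or.inr ⟨j, h1, h2⟩
    · obtain rfl := hd i j y h3 h2
      exact Or.inr ⟨i, h1, h4⟩⟩

lemma sat_closed (hK : ∀ j, IsClosed (K j)) (hnull : ∀ δ > 0, {j | δ ≤ diam (K j)}.Finite)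
    {A : Set S} (hA : IsClosed A) : IsClosed (A ∪ ⋃ j ∈ {j | (K j ∩ A).Nonempty}, K j) := by
  rw [← isOpen_compl_iff, isOpen_iff_mem_nhds]
  intro x hx
  have hxA : x ∉ A := fun h => hx (Or.inl h)
  obtain ⟨d, hd, hball⟩ := Metric.isOpen_iff.1 hA.isOpen_compl x hxA
  have hd2 : 0 < d/2 := by positivity
  let J := {j | d/2 ≤ diam (K j)} ∩ {j | (K j ∩ A).Nonempty}
  have hJ : J.Finite := (hnull _ hd2).subset inter_subset_left
  have hcl : IsClosed (⋃ j ∈ J, K j) := hJ.isClosed_biUnion fun j _ => hK j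
  have hxJ : x ∉ ⋃ j ∈ J, K j := by
    intro h
    obtain ⟨j, hj, hxj⟩ := mem_iUnion₂.1 h
    exact hx (Or.inr (mem_biUnion (x := j) hj.2 hxj))
  filter_upwards [ball_mem_nhds x hd2, hcl.isOpen_compl.mem_nhds hxJ] with y hy hyJ
  rintro (hyA | hyK)
  · exact hball (ball_subset_ball (by linarith) hy) hyA
  · obtain ⟨j, hj, hyj⟩ := mem_iUnion₂.1 hyK
    obtain ⟨a, haK, haA⟩ := hj
    apply hyJ
    refine mem_biUnion (x := j) ⟨?_, ⟨a, haK, haA⟩⟩ hyj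
    by_contra hlt
    rw [mem_ofPred_eq, not_le] at hlt
    have e1 := ddiam haK hyj
    have e2 : dist y x < d/2 := hy
    refine hball (?_ : a ∈ ball x d) haA
    rw [mem_ball]
    linarith [dist_triangle a y x]

theorem exists_quotient (hK : ∀ j, IsClosed (K j)) (hnull : ∀ δ > 0, {j | δ ≤ diam (K j)}.Finite)
    (hd : ∀ i j x, x ∈ K i → x ∈ K j → i = j) :
    ∃ (Y : Type u) (_ : MetricSpace Y) (_ : CompactSpace Y) (π : S → Y), Continuous π ∧
      Function.Surjective π ∧ ∀ x y, π x = π y ↔ (x = y ∨ ∃ j, x ∈ K j ∧ y ∈ K j) := by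
  let := decSetoid K hd
  let π : S → Quotient (decSetoid K hd) := Quotient.mk _
  have hc : Continuous π := continuous_quotient_mk'
  have hs : Function.Surjective π := Quotient.mk_surjective
  have heq : ∀ x y, π x = π y ↔ (x = y ∨ ∃ j, x ∈ K j ∧ y ∈ K j) := fun x y => Quotient.eq
  have hcl : IsClosedMap π := by
    intro A hA
    have hq : IsQuotientMap π := isQuotientMap_quot_mk
    rw [← hq.isClosed_preimage]
    convert sat_closed hK hnull hA using 1
    ext x
    simp only [mem_preimage, mem_image, heq]
    constructor
    · rintro ⟨a, ha, rfl | ⟨j, h1, h2⟩⟩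
      · exact Or.inl ha
      · exact Or.inr (mem_biUnion (x := j) ⟨a, h1, ha⟩ h2)
    · rintro (hx | hx)
      · exact ⟨x, hx, Or.inl rfl⟩
      · obtain ⟨j, ⟨a, h1, h2⟩, h3⟩ := mem_iUnion₂.1 hx
        exact ⟨a, h2, Or.inr ⟨j, h1, h3⟩⟩
  have := t2_of_closed hc hcl hs
  have := sc_of_closed hc hcl hs
  have : CompactSpace (Quotient (decSetoid K hd)) := Quotient.compactSpace
  let := TopologicalSpace.metrizableSpaceMetric (Quotient (decSetoid K hd))
  exact ⟨_, inferInstance, inferInstance, π, hc, hs, heq⟩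

end Shrink

namespace Shrink
universe u
variable {n : ℕ} {S : Type u} [MetricSpace S] [CompactSpace S] {ι : Type*} {K : ι → Set S}

def Shr (n : ℕ) (A : Set S) : Prop := ∃ h : Euc n → S, CellMap h ∧ (h '' ball 0 1)ᶜ = A ∧
  ∃ zs ≠ h 0, ∀ N ∈ 𝓝 zs, ∃ ψ : S ≃ₜ S, (∀ᶠ y in 𝓝 (h 0), ψ y = y) ∧ ∀ y ∈ A, ψ y ∈ N

lemma Shr.image {A : Set S} (hA : Shr n A) (g : S ≃ₜ S) : Shr n (g '' A) := by
  obtain ⟨h, H, rfl, zs, hzs, hψ⟩ := hA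
  refine ⟨g ∘ h, ⟨g.continuous.comp_continuousOn H.cont, g.injective.comp_injOn H.inj, ?_⟩, ?_,
    g zs, fun he => hzs (g.injective he), ?_⟩
  · rw [image_comp]; exact g.isOpenMap _ H.open_ball
  · rw [image_comp, image_compl_eq g.bijective]
  · intro N hN
    obtain ⟨ψ, h1, h2⟩ := hψ (g ⁻¹' N) (g.continuous.continuousAt hN)
    refine ⟨(g.symm.trans ψ).trans g, ?_, ?_⟩
    · have hc : ContinuousAt g.symm ((g ∘ h) 0) := g.symm.continuous.continuousAt
      have he : g.symm ((g ∘ h) 0) = h 0 := g.symm_apply_apply _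
      have h1' : ∀ᶠ y in 𝓝 (g.symm ((g ∘ h) 0)), ψ y = y := by rw [he]; exact h1
      filter_upwards [hc.eventually h1'] with y hy
      show g (ψ (g.symm y)) = y
      rw [hy, g.apply_symm_apply]
    · rintro _ ⟨y, hy, rfl⟩
      show g (ψ (g.symm (g y))) ∈ N
      rw [g.symm_apply_apply]
      exact h2 y hy

lemma Shr.closed {A : Set S} (hA : Shr n A) : IsClosed A := by
  obtain ⟨h, H, rfl, -⟩ := hA
  exact H.open_ball.isClosed_compl

lemma Shr.shrink {A : Set S} (hA : Shr n A) {κ : Type*} {C : κ → Set S} (hC : ∀ j, IsCompact (C j))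
    (hCs : ∀ j, Disjoint (C j) A) (hCd : ∀ δ > 0, {j | δ ≤ diam (C j)}.Finite)
    {W : Set S} (hW : IsOpen W) (hWK : A ⊆ W) {ε : ℝ} (hε : 0 < ε) :
    ∃ θ : S ≃ₜ S, (∀ y ∉ W, θ y = y) ∧ diam (θ '' A) < ε ∧
      ∀ j, (∀ y ∈ C j, θ y = y) ∨ diam (θ '' C j) < ε := by
  obtain ⟨h, H, rfl, hψ⟩ := hA
  exact shrink_one H hψ hC (fun j => disjoint_compl_right_iff_subset.1 (hCs j)) hCd hW hWK hε

lemma null_image (hnull : ∀ δ > 0, {j | δ ≤ diam (K j)}.Finite) (g : S ≃ₜ S) :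
    ∀ δ > 0, {j | δ ≤ diam (g '' K j)}.Finite := by
  intro δ hδ
  obtain ⟨η, hη, hh⟩ := Metric.uniformContinuous_iff.1
    (CompactSpace.uniformContinuous_of_continuous g.continuous) (δ/2) (by positivity)
  refine (hnull η hη).subset ?_
  intro j hj
  by_contra hlt
  rw [mem_ofPred_eq, not_le] at hlt
  rw [mem_ofPred_eq] at hj
  have : diam (g '' K j) ≤ δ/2 := by
    refine diam_le_of_forall_dist_le (by positivity) ?_
    rintro _ ⟨x, hx, rfl⟩ _ ⟨y, hy, rfl⟩
    exact (hh ((ddiam hx hy).trans_lt hlt)).le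
  linarith

variable {Y : Type*} [MetricSpace Y] {π : S → Y}

theorem shrink_many (hS : ∀ j, Shr n (K j)) (hnull : ∀ δ > 0, {j | δ ≤ diam (K j)}.Finite)
    (hd : ∀ i j x, x ∈ K i → x ∈ K j → i = j) {F : Set S} (hF : IsClosed F)
    (hFK : ∀ j, ∀ x ∈ K j, x ∉ F) (hπ : Continuous π) (hπK : ∀ j, ∀ x ∈ K j, ∀ y ∈ K j, π x = π y)
    {ε : ℝ} (hε : 0 < ε) (m : ℕ) : ∀ g : S ≃ₜ S, (∀ x ∈ F, g x = x) →
      {j | ε ≤ diam (g '' K j)}.ncard ≤ m → ∀ δ > 0, ∃ g' : S ≃ₜ S, (∀ x ∈ F, g' x = x) ∧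
        (∀ j, diam (g' '' K j) < ε) ∧ ∀ y, dist (π (g'.symm y)) (π (g.symm y)) < δ := by
  induction m with
  | zero =>
    intro g hg hm δ hδ
    have hfin := null_image hnull g ε hε
    have he : {j | ε ≤ diam (g '' K j)} = ∅ := (ncard_eq_zero hfin).1 (Nat.le_zero.1 hm)
    refine ⟨g, hg, fun j => ?_, fun y => by rw [dist_self]; exact hδ⟩
    by_contra hj
    have : j ∈ {j | ε ≤ diam (g '' K j)} := not_lt.1 hj
    rw [he] at this
    exact this
  | succ m ih =>
    intro g hg hm δ hδ
    have hfin := null_image hnull g ε hε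
    by_cases hemp : {j | ε ≤ diam (g '' K j)} = ∅
    · exact ih g hg (by rw [hemp]; simp) δ hδ
    obtain ⟨j, hj⟩ := nonempty_iff_ne_empty.2 hemp
    have hne : (K j).Nonempty := by
      by_contra hne
      rw [not_nonempty_iff_eq_empty] at hne
      rw [mem_ofPred_eq, hne] at hj
      simp at hj
      linarith
    obtain ⟨k, hk⟩ := hne
    let W : Set S := {y | dist (π (g.symm y)) (π k) < δ/4} ∩ Fᶜ
    have hfc : Continuous fun y => dist (π (g.symm y)) (π k) :=
      (hπ.comp g.symm.continuous).dist continuous_const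
    have hW : IsOpen W := (isOpen_lt hfc continuous_const).inter hF.isOpen_compl
    have hWK : g '' K j ⊆ W := by
      rintro _ ⟨x, hx, rfl⟩
      refine ⟨?_, ?_⟩
      · show dist (π (g.symm (g x))) (π k) < δ/4
        rw [g.symm_apply_apply, hπK j x hx k hk, dist_self]; positivity
      · intro hxF
        have : g x = x := g.injective (hg _ hxF)
        rw [this] at hxF
        exact hFK j x hx hxF
    obtain ⟨θ, hθ1, hθ2, hθ3⟩ := ((hS j).image g).shrink (κ := {i // i ≠ j}) (C := fun i => g '' K i)
      (fun i => (g.isClosedMap _ (hS i).closed).isCompact)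
      (fun i => by
        rw [Set.disjoint_left]
        rintro _ ⟨x, hx, rfl⟩ ⟨y, hy, he⟩
        have := g.injective he
        rw [this] at hy
        exact i.2 (hd _ _ x hx hy))
      (fun δ hδ => Set.Finite.preimage (f := (Subtype.val : {i // i ≠ j} → ι))
        (s := {i | δ ≤ diam (g '' K i)}) Subtype.val_injective.injOn (null_image hnull g δ hδ)) hW hWK hε
    have hθW : ∀ y ∈ W, θ.symm y ∈ W := by
      intro y hy
      by_contra hc
      have := hθ1 _ hc
      rw [θ.apply_symm_apply] at this
      rw [← this] at hc
      exact hc hy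
    have hsub : {i | ε ≤ diam (g.trans θ '' K i)} ⊂ {i | ε ≤ diam (g '' K i)} := by
      have him : ∀ i, g.trans θ '' K i = θ '' (g '' K i) := fun i => by
        rw [← image_comp]; rfl
      rw [ssubset_iff_of_subset]
      · refine ⟨j, hj, ?_⟩
        rw [mem_ofPred_eq, him, not_le]; exact hθ2
      · intro i hi
        rw [mem_ofPred_eq, him] at hi
        by_cases hij : i = j
        · rw [hij] at hi
          linarith
        · rcases hθ3 ⟨i, hij⟩ with h1 | h1
          · have : θ '' (g '' K i) = g '' K i := by
              rw [image_congr (g := id) h1, image_id]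
            rw [this] at hi
            exact hi
          · simp only at h1
            linarith
    have hcard := ncard_lt_ncard hsub hfin
    obtain ⟨g', h1, h2, h3⟩ := ih (g.trans θ) (by
      intro x hx
      show θ (g x) = x
      rw [hg x hx]
      exact hθ1 x fun h => h.2 hx) (by omega) (δ/2) (by positivity)
    refine ⟨g', h1, h2, fun y => ?_⟩
    have e1 := h3 y
    have e2 : dist (π ((g.trans θ).symm y)) (π (g.symm y)) ≤ δ/2 := by
      show dist (π (g.symm (θ.symm y))) (π (g.symm y)) ≤ δ/2
      by_cases hy : y ∈ W
      · have a1 : dist (π (g.symm (θ.symm y))) (π k) < δ/4 := (hθW y hy).1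
        have a2 : dist (π (g.symm y)) (π k) < δ/4 := hy.1
        have := dist_triangle_right (π (g.symm (θ.symm y))) (π (g.symm y)) (π k)
        linarith
      · have : θ.symm y = y := by
          rw [θ.symm_apply_eq]
          exact (hθ1 y hy).symm
        rw [this, dist_self]; positivity
    linarith [dist_triangle (π (g'.symm y)) (π ((g.trans θ).symm y)) (π (g.symm y))]

lemma isOpen_fib (ε : ℝ) : IsOpen {f : C(S, Y) | ∀ x y, f x = f y → dist x y < ε} := by
  rw [Metric.isOpen_iff]
  intro f hf
  let D : Set (S × S) := {p | ε ≤ dist p.1 p.2}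
  have hD : IsCompact D := (isClosed_le continuous_const (continuous_fst.dist continuous_snd)).isCompact
  rcases D.eq_empty_or_nonempty with he | hne
  · refine ⟨1, one_pos, fun f' _ x y _ => ?_⟩
    by_contra hlt
    have : (x, y) ∈ D := not_lt.1 hlt
    rw [he] at this; exact this
  · have hc : Continuous fun p : S × S => dist (f p.1) (f p.2) := by fun_prop
    obtain ⟨p, hp, hmin⟩ := hD.exists_isMinOn hne hc.continuousOn
    have hm : 0 < dist (f p.1) (f p.2) := by
      rw [dist_pos]
      intro he
      exact absurd (hf _ _ he) (not_lt.2 hp)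
    refine ⟨dist (f p.1) (f p.2) / 2, by positivity, fun f' hf' x y hxy => ?_⟩
    by_contra hlt
    have hxyD : (x, y) ∈ D := not_lt.1 hlt
    have e1 : dist (f p.1) (f p.2) ≤ dist (f x) (f y) := hmin hxyD
    rw [mem_ball] at hf'
    have e2 := (ContinuousMap.dist_apply_le_dist (f := f') (g := f) x).trans_lt hf'
    have e3 := (ContinuousMap.dist_apply_le_dist (f := f') (g := f) y).trans_lt hf'
    have e4 := dist_triangle4 (f x) (f' x) (f' y) (f y)
    rw [hxy, dist_self, ← hxy, dist_comm (f x) (f' x)] at e4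
    rw [← hxy] at e3
    linarith

theorem exists_collapse (hS : ∀ j, Shr n (K j)) (hnull : ∀ δ > 0, {j | δ ≤ diam (K j)}.Finite)
    (hd : ∀ i j x, x ∈ K i → x ∈ K j → i = j) {F : Set S} (hF : IsClosed F)
    (hFK : ∀ j, ∀ x ∈ K j, x ∉ F) :
    ∃ p : S → S, Continuous p ∧ Function.Surjective p ∧ (∀ x ∈ F, p x = x) ∧
      ∀ x y, p x = p y ↔ (x = y ∨ ∃ j, x ∈ K j ∧ y ∈ K j) := by
  obtain ⟨Y, hY1, hY2, π, hπ, hπs, hπe⟩ := exists_quotient (fun j => (hS j).closed) hnull hd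
  have hπK : ∀ j, ∀ x ∈ K j, ∀ y ∈ K j, π x = π y := fun j x hx y hy => (hπe x y).2 (Or.inr ⟨j, hx, hy⟩)
  let A : Set C(S, Y) := {f | ∃ g : S ≃ₜ S, (∀ x ∈ F, g x = x) ∧ ∀ y, f y = π (g.symm y)}
  let E : Set C(S, Y) := closure A
  have hEc : IsClosed E := isClosed_closure
  have : CompleteSpace E := hEc.completeSpace_coe
  have hAE : A ⊆ E := subset_closure
  let O : ℕ → Set E := fun k => {f | ∀ x y, f.1 x = f.1 y → dist x y < 1/((k:ℝ)+1)}
  have hO : ∀ k, IsOpen (O k) := fun k => (isOpen_fib _).preimage continuous_subtype_val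
  have hOd : ∀ k, Dense (O k) := by
    intro k
    rw [Metric.dense_iff]
    intro f r hr
    obtain ⟨f1, ⟨g, hg, hgf⟩, hf1⟩ := Metric.mem_closure_iff.1 f.2 (r/2) (by positivity)
    obtain ⟨g', h1, h2, h3⟩ := shrink_many hS hnull hd hF hFK hπ hπK
      (ε := 1/((k:ℝ)+1)) (by positivity) _ g hg le_rfl (r/4) (by positivity)
    let f2 : C(S, Y) := ⟨fun y => π (g'.symm y), hπ.comp g'.symm.continuous⟩
    have hf2A : f2 ∈ A := ⟨g', h1, fun y => rfl⟩
    refine ⟨⟨f2, hAE hf2A⟩, ?_, ?_⟩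
    · rw [mem_ball]
      show dist f2 f.1 < r
      have e1 : dist f2 f1 ≤ r/4 := by
        rw [ContinuousMap.dist_le (by positivity)]
        intro y
        rw [hgf y]
        exact (h3 y).le
      have := dist_triangle f2 f1 f.1
      rw [dist_comm f1] at this
      linarith
    · intro x y hxy
      rcases (hπe _ _).1 hxy with he | ⟨j, hx, hy⟩
      · rw [g'.symm.injective he, dist_self]; positivity
      · exact (ddiam (A := g' '' K j) ⟨_, hx, g'.apply_symm_apply x⟩ ⟨_, hy, g'.apply_symm_apply y⟩).trans_lt (h2 j)
  have hdense := dense_iInter_of_isOpen_nat hO hOd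
  have hEne : Nonempty E := ⟨⟨⟨π, hπ⟩, hAE ⟨Homeomorph.refl S, fun x _ => rfl, fun y => rfl⟩⟩⟩
  obtain ⟨⟨f, hfE⟩, hfO⟩ := hdense.nonempty
  have hinj : Function.Injective f := by
    intro x y hxy
    by_contra hne
    obtain ⟨k, hk⟩ := exists_nat_one_div_lt (dist_pos.2 hne)
    exact lt_asymm hk (mem_iInter.1 hfO k x y hxy)
  have hfF : ∀ x ∈ F, f x = π x := by
    intro x hx
    have : IsClosed {f : C(S, Y) | f x = π x} :=
      isClosed_eq (continuous_eval_const x) continuous_const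
    refine (this.closure_subset_iff (s := A)).2 ?_ hfE
    rintro f' ⟨g, hg, hgf⟩
    show f' x = π x
    rw [hgf x]
    congr 1
    rw [g.symm_apply_eq, hg x hx]
  have hsurj : Function.Surjective f := by
    intro y
    have hcl : IsClosed (range f) := (isCompact_range f.continuous).isClosed
    suffices h : y ∈ closure (range f) by rw [hcl.closure_eq] at h; exact h
    rw [Metric.mem_closure_iff]
    intro r hr
    obtain ⟨f1, ⟨g, hg, hgf⟩, hf1⟩ := Metric.mem_closure_iff.1 hfE r hr
    obtain ⟨x, rfl⟩ := hπs y
    refine ⟨f (g x), mem_range_self _, ?_⟩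
    have := (ContinuousMap.dist_apply_le_dist (f := f) (g := f1) (g x)).trans_lt hf1
    rw [hgf, g.symm_apply_apply, dist_comm] at this
    exact this
  let e : S ≃ Y := Equiv.ofBijective f ⟨hinj, hsurj⟩
  have hecont : Continuous e := f.continuous
  let e' : S ≃ₜ Y := hecont.homeoOfEquivCompactToT2
  refine ⟨fun x => e'.symm (π x), e'.symm.continuous.comp hπ, e'.symm.surjective.comp hπs, ?_, ?_⟩
  · intro x hx
    show e'.symm (π x) = x
    rw [e'.symm_apply_eq]
    exact (hfF x hx).symm
  · intro x y
    show e'.symm (π x) = e'.symm (π y) ↔ _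
    rw [e'.symm.injective.eq_iff]
    exact hπe x y

end Shrink


namespace Shrink

lemma exists_cube (n : ℕ) : ∃ γ : Euc n → (Fin n → ↥(Set.Icc (0:ℝ) 1)), Continuous γ ∧
    InjOn γ (closedBall 0 1) ∧ γ '' closedBall 0 1 = univ := by
  let s : Set (Euc n) := {x | ∀ i, x i ∈ Icc (0:ℝ) 1}
  have hcoord : ∀ i, Continuous fun x : Euc n => x i := fun i => by fun_prop
  have hsc : IsClosed s := by
    have : s = ⋂ i, (fun x : Euc n => x i) ⁻¹' Icc 0 1 := by ext; simp [s]
    rw [this]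
    exact isClosed_iInter fun i => isClosed_Icc.preimage (hcoord i)
  have hconv : Convex ℝ s := by
    intro x hx y hy a b ha hb hab i
    have := convex_Icc (0:ℝ) 1 (hx i) (hy i) ha hb hab
    simpa using this
  have hintne : (interior s).Nonempty := by
    refine ⟨WithLp.toLp 2 fun _ => 1/2, ?_⟩
    have ho : IsOpen (⋂ i, (fun x : Euc n => x i) ⁻¹' Ioo 0 1) :=
      isOpen_iInter_of_finite fun i => isOpen_Ioo.preimage (hcoord i)
    refine interior_maximal ?_ ho ?_
    · intro x hx i
      exact Ioo_subset_Icc_self (mem_iInter.1 hx i)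
    · rw [mem_iInter]
      intro i
      simp only [mem_preimage, mem_Ioo]
      norm_num
  have hbd : Bornology.IsBounded s := by
    refine (isBounded_closedBall (x := (0 : Euc n)) (r := Real.sqrt n)).subset ?_
    intro x hx
    rw [mem_closedBall_zero_iff, EuclideanSpace.norm_eq]
    apply Real.sqrt_le_sqrt
    calc ∑ i, ‖x i‖^2 ≤ ∑ i : Fin n, (1:ℝ) := by
          apply Finset.sum_le_sum
          intro i _
          rw [Real.norm_eq_abs, sq_abs]
          have := hx i
          nlinarith [this.1, this.2]
      _ = n := by simp
  obtain ⟨e, -, he, -⟩ := exists_homeomorph_image_interior_closure_frontier_eq_unitBall hconv hintne hbd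
  rw [hsc.closure_eq] at he
  have hes : ∀ x ∈ closedBall (0 : Euc n) 1, e.symm x ∈ s := by
    intro x hx
    rw [← he] at hx
    obtain ⟨y, hy, rfl⟩ := hx
    rwa [e.symm_apply_apply]
  refine ⟨fun x i => projIcc 0 1 zero_le_one (e.symm x i), ?_, ?_, ?_⟩
  · exact continuous_pi fun i => continuous_projIcc.comp ((hcoord i).comp e.symm.continuous)
  · intro x hx y hy hxy
    apply e.symm.injective
    ext i
    have := congrArg Subtype.val (congrFun hxy i)
    simp only [projIcc_of_mem zero_le_one (hes x hx i), projIcc_of_mem zero_le_one (hes y hy i)] at this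
    exact this
  · rw [eq_univ_iff_forall]
    intro c
    let y : Euc n := WithLp.toLp 2 fun i => (c i : ℝ)
    have hy : y ∈ s := fun i => (c i).2
    refine ⟨e y, he ▸ mem_image_of_mem e hy, ?_⟩
    funext i
    show projIcc 0 1 zero_le_one (e.symm (e y) i) = c i
    rw [e.symm_apply_apply]
    exact projIcc_val zero_le_one (c i)

instance (n : ℕ) : CompactSpace ↥(Sph n) := isCompact_iff_compactSpace.1 (isCompact_sphere _ _)

lemma exists_cell {n : ℕ} {U : Set (Euc (n+1))} (hU : IsCell n (Sph n \ U)) :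
    ∃ h : Euc n → ↥(Sph n), CellMap h ∧ h '' closedBall 0 1 = {x : ↥(Sph n) | (x : Euc (n+1)) ∉ U} := by
  obtain ⟨φ⟩ := hU
  obtain ⟨γ, hc, hi, hs⟩ := exists_cube n
  let h : Euc n → ↥(Sph n) := fun x => ⟨(φ.symm (γ x)).1, (φ.symm (γ x)).2.1⟩
  have hcont : Continuous h :=
    Continuous.subtype_mk (continuous_subtype_val.comp (φ.symm.continuous.comp hc)) _
  have hinj : InjOn h (closedBall 0 1) := by
    intro x hx y hy hxy
    apply hi hx hy
    apply φ.symm.injective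
    exact Subtype.ext (congrArg (fun w : ↥(Sph n) => (w : Euc (n+1))) hxy)
  refine ⟨h, ⟨hcont.continuousOn, hinj, ?_⟩, ?_⟩
  · exact InvDom.isOpen_image_chart h _ isOpen_ball hcont.continuousOn (hinj.mono ball_subset_closedBall)
  · ext x
    constructor
    · rintro ⟨y, hy, rfl⟩
      exact (φ.symm (γ y)).2.2
    · intro hx
      have : φ ⟨x.1, x.2, hx⟩ ∈ γ '' closedBall 0 1 := by rw [hs]; trivial
      obtain ⟨y, hy, hye⟩ := this
      refine ⟨y, hy, ?_⟩
      apply Subtype.ext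
      show (φ.symm (γ y)).1 = x.1
      rw [hye, φ.symm_apply_apply]

lemma compl_ball_eq {n : ℕ} {U : Set (Euc (n+1))} (hU : U ⊆ Sph n) {h : Euc n → ↥(Sph n)}
    (H : CellMap h) (hh : h '' closedBall 0 1 = {x : ↥(Sph n) | (x : Euc (n+1)) ∉ U}) :
    (h '' ball 0 1)ᶜ = {x : ↥(Sph n) | (x : Euc (n+1)) ∈ closure U} := by
  have hcl : {x : ↥(Sph n) | (x : Euc (n+1)) ∈ closure U} = closure (h '' closedBall 0 1)ᶜ := by
    rw [hh, IsInducing.subtypeVal.closure_eq_preimage_closure_image]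
    have himg : Subtype.val '' {x : ↥(Sph n) | (x : Euc (n+1)) ∉ U}ᶜ = U := by
      ext y
      constructor
      · rintro ⟨z, hz, rfl⟩
        exact not_not.1 hz
      · intro hy
        exact ⟨⟨y, hU hy⟩, fun hc => hc hy, rfl⟩
    rw [himg]
    rfl
  rw [hcl]
  apply Subset.antisymm
  · intro y hy
    by_cases hy' : y ∈ h '' closedBall 0 1
    · obtain ⟨x, hx, rfl⟩ := hy'
      exact InvDom.sphere_subset_closure h H.cont H.inj x (H.norm_eq_one (mem_closedBall_zero_iff.1 hx) hy)
    · exact subset_closure hy'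
  · exact closure_minimal (compl_subset_compl.2 (image_mono ball_subset_closedBall))
      H.open_ball.isClosed_compl

lemma sphere_squeeze {n : ℕ} (z : ↥(Sph n)) : ∃ zs ≠ z, ∀ A : Set ↥(Sph n), IsClosed A → z ∉ A →
    ∀ N ∈ 𝓝 zs, ∃ ψ : ↥(Sph n) ≃ₜ ↥(Sph n), (∀ᶠ y in 𝓝 z, ψ y = y) ∧ ∀ y ∈ A, ψ y ∈ N := by
  have := Fact.mk (@finrank_euclideanSpace_fin ℝ _ (n + 1))
  let τ := stereographic' n z
  have hsrc : τ.source = {z}ᶜ := stereographic'_source z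
  have htgt : τ.target = univ := stereographic'_target z
  have hτc : Continuous τ.symm := by
    rw [← continuousOn_univ, ← htgt]; exact τ.continuousOn_symm
  have hτz : ∀ x, τ.symm x ≠ z := by
    intro x
    have : τ.symm x ∈ τ.source := τ.map_target (by rw [htgt]; trivial)
    rw [hsrc] at this
    exact this
  have hτr : ∀ x, τ (τ.symm x) = x := fun x => τ.right_inv (by rw [htgt]; trivial)
  have hτl : ∀ y ≠ z, τ.symm (τ y) = y := fun y hy => τ.left_inv (by rw [hsrc]; exact hy)
  refine ⟨τ.symm 0, hτz 0, ?_⟩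
  intro A hA hzA N hN
  have hAc : IsCompact A := hA.isCompact
  have hτA : ContinuousOn τ A := τ.continuousOn.mono (by
    rw [hsrc]
    intro y hy hyz
    rw [mem_singleton_iff] at hyz
    exact hzA (hyz ▸ hy))
  obtain ⟨R0, hR0⟩ := (hAc.image_of_continuousOn hτA).isBounded.exists_norm_le
  set R : ℝ := 2 * |R0| + 1 with hR
  have hRpos : 0 < R := by positivity
  let e : Euc n → ↥(Sph n) := fun x => τ.symm (R • x)
  have hec : Continuous e := hτc.comp (continuous_const_smul R)
  have hei : Function.Injective e := by
    intro x y hxy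
    have : R • x = R • y := by rw [← hτr (R • x), ← hτr (R • y)]; exact congrArg τ hxy
    exact smul_right_injective _ hRpos.ne' this
  have H : CellMap e := ⟨hec.continuousOn, hei.injOn,
    InvDom.isOpen_image_chart e _ isOpen_ball hec.continuousOn hei.injOn⟩
  have he0 : e 0 = τ.symm 0 := by simp [e]
  have hN' : e ⁻¹' N ∈ 𝓝 (0 : Euc n) := by
    apply hec.continuousAt
    rw [he0]; exact hN
  obtain ⟨s0, hs0, hsN⟩ := Metric.mem_nhds_iff.1 hN'
  obtain ⟨r0, -, hr0, hr01, μ, h0, h1, hμ, -⟩ := exists_reparam (fun _ _ => False)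
    (fun r _ => ⟨0, one_pos, fun _ _ h => h.elim⟩) (σ := min (s0/2) (1/2)) (κ := 1) (rs := 0)
    (by positivity) ((min_le_right _ _).trans_lt (by norm_num)) one_pos one_pos
  obtain ⟨Φ, hΦ, -, hΦo⟩ := H.exists_radial h0 h1
  refine ⟨Φ, ?_, ?_⟩
  · have : z ∈ (e '' closedBall 0 1)ᶜ := by
      rintro ⟨x, -, hx⟩
      exact hτz _ hx
    filter_upwards [H.closed.isOpen_compl.mem_nhds this] with y hy
    exact (hΦo y fun hc => hy (image_mono ball_subset_closedBall hc)).1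
  · intro y hy
    have hyz : y ≠ z := fun h => hzA (h ▸ hy)
    have hle : ‖τ y‖ ≤ |R0| := (hR0 _ ⟨y, hy, rfl⟩).trans (le_abs_self _)
    let x := R⁻¹ • τ y
    have hex : e x = y := by
      show τ.symm (R • (R⁻¹ • τ y)) = y
      rw [smul_inv_smul₀ hRpos.ne', hτl y hyz]
    have hx : ‖x‖ ≤ 1/2 := by
      show ‖R⁻¹ • τ y‖ ≤ 1/2
      rw [norm_smul, norm_inv, Real.norm_of_nonneg hRpos.le, inv_mul_le_iff₀ hRpos]
      linarith
    rw [← hex, hΦ x (by linarith)]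
    apply hsN
    rw [mem_ball_zero_iff, norm_rad h0]
    have := μ.monotone (hx.trans hr0.le)
    linarith [min_le_left (s0/2) (1/2 : ℝ)]

lemma shr_sphere {n : ℕ} {U : Set (Euc (n+1))} (hUS : U ⊆ Sph n) (hU : IsCell n (Sph n \ U)) :
    Shr n {x : ↥(Sph n) | (x : Euc (n+1)) ∈ closure U} := by
  obtain ⟨h, H, hh⟩ := exists_cell hU
  have he := compl_ball_eq hUS H hh
  obtain ⟨zs, hzs, hsq⟩ := sphere_squeeze (h 0)
  refine ⟨h, H, he, zs, hzs, hsq _ ?_ ?_⟩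
  · rw [← he]; exact H.open_ball.isClosed_compl
  · rw [← he]
    intro hc
    exact hc ⟨0, by simp, rfl⟩

end Shrink

/-- **Decomposition Lemma.** Given a Sierpiński space `X ⊆ S^n` with complementary components
`U_j`, `j ≥ 1`, and `N ∈ ℕ`, there is a continuous surjection `p : S^n → S^n` fixing
`⋃_{j=1}^N closure (U j)` pointwise, collapsing each `closure (U j)`, `j ≥ N+1`, to a point
`q j`, and restricting to a bijection off the collapsed sets. -/
theorem exists_decomposition_map (n : ℕ) (hn : 2 ≤ n)
    (X : Set (Euc (n+1))) (hX : IsSierpinski n X)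
    (U : ℕ → Set (Euc (n+1)))
    (hUcomp : ∀ j, 1 ≤ j → U j ∈ connComps n X)
    (hUenum : ∀ V ∈ connComps n X, ∃ j, 1 ≤ j ∧ V = U j)
    (hUinj : Set.InjOn U (Set.Ici 1))
    (N : ℕ) :
    ∃ p : ↥(Sph n) → ↥(Sph n),
      Continuous p ∧ Function.Surjective p ∧
      (∀ x : ↥(Sph n), (x : Euc (n+1)) ∈ ⋃ j ∈ Set.Icc 1 N, closure (U j) → p x = x) ∧
      ∃ q : ℕ → ↥(Sph n),
        (∀ j, N + 1 ≤ j →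
          p ⁻¹' {q j} = {x : ↥(Sph n) | (x : Euc (n+1)) ∈ closure (U j)}) ∧
        Set.BijOn p
          {x : ↥(Sph n) | (x : Euc (n+1)) ∉ ⋃ j ∈ Set.Ici (N+1), closure (U j)}
          {y : ↥(Sph n) | ∀ j, N + 1 ≤ j → y ≠ q j} := by
  obtain ⟨U', hU'inj, hU'c, hU's, hU'cell, hU'd, -, hU't⟩ := hX.exists_enum
  have hsub : ∀ j, 1 ≤ j → U j ⊆ Sph n := by
    intro j hj
    obtain ⟨x, hx, he⟩ := hUcomp j hj
    rw [he]
    exact (connectedComponentIn_subset _ _).trans sdiff_subset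
  have hne : ∀ j, 1 ≤ j → (U j).Nonempty := by
    intro j hj
    obtain ⟨x, hx, he⟩ := hUcomp j hj
    exact ⟨x, he ▸ mem_connectedComponentIn hx⟩
  have hidx : ∀ j, ∃ i, 1 ≤ j → U j = U' i := by
    intro j
    by_cases hj : 1 ≤ j
    · obtain ⟨i, hi⟩ := hU's _ (hUcomp j hj)
      exact ⟨i, fun _ => hi⟩
    · exact ⟨0, fun h => absurd h hj⟩
  choose idx hidx using hidx
  have hdisj : ∀ i j, 1 ≤ i → 1 ≤ j → ∀ x, x ∈ closure (U i) → x ∈ closure (U j) → i = j := by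
    intro i j hi hj x hxi hxj
    by_contra hij
    have hne : idx i ≠ idx j := by
      intro h
      apply hij
      apply hUinj hi hj
      rw [hidx i hi, hidx j hj, h]
    rw [hidx i hi] at hxi
    rw [hidx j hj] at hxj
    have : x ∈ closure (U' (idx i)) ∩ closure (U' (idx j)) := ⟨hxi, hxj⟩
    rw [hU'd _ _ hne] at this
    exact this
  have hbd : ∀ j, 1 ≤ j → Bornology.IsBounded (U j) := fun j hj =>
    isBounded_sphere.subset (hsub j hj)
  let K : {j : ℕ // N + 1 ≤ j} → Set ↥(Sph n) := fun j => {x | (x : Euc (n+1)) ∈ closure (U j)}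
  have h1 : ∀ j : {j : ℕ // N + 1 ≤ j}, 1 ≤ (j : ℕ) := fun j => le_trans (by omega) j.2
  have hnull : ∀ δ > 0, {j | δ ≤ diam (K j)}.Finite := by
    intro δ hδ
    have hfin : {i | δ ≤ diam (U' i)}.Finite := by
      have := hU't.eventually (gt_mem_nhds hδ)
      rw [← Nat.cofinite_eq_atTop, eventually_cofinite] at this
      simpa only [not_lt] using this
    refine Set.Finite.of_finite_image (f := fun j => idx j) (hfin.subset ?_) ?_
    · rintro _ ⟨j, hj, rfl⟩
      rw [mem_ofPred_eq] at hj ⊢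
      rw [← hidx j (h1 j), ← diam_closure]
      refine hj.trans ?_
      refine diam_le_of_forall_dist_le diam_nonneg ?_
      intro x hx y hy
      exact dist_le_diam_of_mem (hbd j (h1 j)).closure hx hy
    · intro i _ j _ hij
      apply Subtype.ext
      apply hUinj (h1 i) (h1 j)
      simp only at hij
      rw [hidx i (h1 i), hidx j (h1 j), hij]
  obtain ⟨p, hpc, hps, hpF, hpe⟩ := Shrink.exists_collapse (n := n) (K := K)
    (F := {x | (x : Euc (n+1)) ∈ ⋃ j ∈ Set.Icc 1 N, closure (U j)})
    (fun j => Shrink.shr_sphere (hsub j (h1 j)) (by rw [hidx j (h1 j)]; exact hU'cell _)) hnull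
    (fun i j x hi hj => Subtype.ext (hdisj i j (h1 i) (h1 j) x hi hj))
    (((Set.finite_Icc 1 N).isClosed_biUnion fun j _ => isClosed_closure).preimage continuous_subtype_val)
    (by
      intro j x hx hxF
      obtain ⟨i, hi, hxi⟩ := mem_iUnion₂.1 hxF
      have := hdisj i j hi.1 (h1 j) x hxi hx
      have h2 := j.2
      have h3 := hi.2
      omega)
  refine ⟨p, hpc, hps, hpF, ?_⟩
  have hq : ∀ j, ∃ q, N + 1 ≤ j → p ⁻¹' {q} = {x : ↥(Sph n) | (x : Euc (n+1)) ∈ closure (U j)} := by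
    intro j
    by_cases hj : N + 1 ≤ j
    · obtain ⟨k, hk⟩ := hne j (by omega)
      let k' : ↥(Sph n) := ⟨k, hsub j (by omega) hk⟩
      have hk' : k' ∈ K ⟨j, hj⟩ := subset_closure hk
      refine ⟨p k', fun _ => ?_⟩
      ext x
      rw [mem_preimage, mem_singleton_iff, hpe]
      constructor
      · rintro (rfl | ⟨i, hx, hki⟩)
        · exact hk'
        · have := hdisj i j (h1 i) (by omega) k hki hk'
          have hx' : (x : Euc (n+1)) ∈ closure (U i) := hx
          rw [this] at hx'
          exact hx'
      · intro hx
        exact Or.inr ⟨⟨j, hj⟩, hx, hk'⟩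
    · obtain ⟨x, hx⟩ := hX.isConnected.nonempty
      exact ⟨⟨x, hX.subset hx⟩, fun h => absurd h hj⟩
  choose q hq using hq
  refine ⟨q, hq, ?_, ?_, ?_⟩
  · intro x hx j hj he
    have : x ∈ p ⁻¹' {q j} := he
    rw [hq j hj] at this
    exact hx (mem_biUnion (x := j) hj this)
  · intro x hx y hy hxy
    rcases (hpe x y).1 hxy with h | ⟨j, hj, -⟩
    · exact h
    · exact absurd (mem_biUnion (x := (j : ℕ)) j.2 hj) hx
  · intro y hy
    obtain ⟨x, rfl⟩ := hps y
    refine ⟨x, ?_, rfl⟩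
    intro hx
    obtain ⟨j, hj, hxj⟩ := mem_iUnion₂.1 hx
    have : x ∈ p ⁻¹' {q j} := by rw [hq j hj]; exact hxj
    exact hy j hj this
end
end

section
/- Let n ≥ 2, let {B_i}_{i∈ℕ} be a sequence of pairwise disjoint flat n-cells in S^n with diam(B_i) → 0 as i → ∞, and let U ⊂ S^n be an open set containing ⋃_{i∈ℕ} B_i. Then there exists a continuous surjection f : S^n → S^n which is the identity on S^n \ U, and there exist points p_i ∈ U, i ∈ ℕ, such that f^{-1}(p_i) = B_i for each i ∈ ℕ, and f restricted to S^n \ ⋃_{i∈ℕ} B_i is a bijection onto S^n \ {p_i : i ∈ ℕ}. -/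
open Metric Set Topology Filter MeasureTheory

noncomputable section

/-- `D ⊆ S^n` is a flat `n`-cell: some self-homeomorphism of `S^n` maps it onto the closed
lower hemisphere `{x ∈ S^n : x_{n+1} ≤ 0}`. -/
def IsFlatCell (n : ℕ) (D : Set (Euc (n+1))) : Prop :=
  D ⊆ Sph n ∧ ∃ F : ↥(Sph n) ≃ₜ ↥(Sph n),
    F '' {x : ↥(Sph n) | (x : Euc (n+1)) ∈ D} =
      {x : ↥(Sph n) | (x : Euc (n+1)) (Fin.last n) ≤ 0}

set_option linter.unusedSectionVars false

namespace Decomp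

def sg (a δ η r : ℝ) : ℝ := 1 - η * max 0 (min 1 ((a + δ - r) / δ))

lemma sg_cont (a δ η : ℝ) : Continuous (sg a δ η) := by
  unfold sg; fun_prop

lemma sg_mono {a δ η : ℝ} (hδ : 0 < δ) (hη : 0 ≤ η) : Monotone (sg a δ η) := by
  intro r s hrs
  unfold sg
  have : (a + δ - s) / δ ≤ (a + δ - r) / δ := by gcongr
  gcongr

lemma sg_le_one {a δ η r : ℝ} (hη : 0 ≤ η) : sg a δ η r ≤ 1 := by
  unfold sg
  have : 0 ≤ η * max 0 (min 1 ((a + δ - r) / δ)) := mul_nonneg hη (le_max_left _ _)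
  linarith

lemma sg_ge {a δ η r : ℝ} (hη : 0 ≤ η) : 1 - η ≤ sg a δ η r := by
  unfold sg
  have : max 0 (min 1 ((a + δ - r) / δ)) ≤ 1 := max_le zero_le_one (min_le_left _ _)
  nlinarith

lemma sg_eq_one {a δ η r : ℝ} (hδ : 0 < δ) (hr : a + δ ≤ r) : sg a δ η r = 1 := by
  unfold sg
  have : (a + δ - r) / δ ≤ 0 := div_nonpos_of_nonpos_of_nonneg (by linarith) hδ.le
  rw [max_eq_left ((min_le_right _ _).trans this)]; simp

lemma sg_eq {a δ η r : ℝ} (hδ : 0 < δ) (hr : r ≤ a) : sg a δ η r = 1 - η := by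
  unfold sg
  have : 1 ≤ (a + δ - r) / δ := by rw [le_div_iff₀ hδ]; linarith
  rw [min_eq_left this, max_eq_right zero_le_one]; simp

section radial
variable {E : Type*} [NormedAddCommGroup E] [NormedSpace ℝ E]

def rad (a δ η : ℝ) (w : E) : E := sg a δ η ‖w‖ • w

lemma rad_cont (a δ η : ℝ) : Continuous (rad a δ η : E → E) := by
  unfold rad
  exact ((sg_cont a δ η).comp continuous_norm).smul continuous_id

lemma norm_rad {a δ η : ℝ} (hη : 0 ≤ η) (hη1 : η < 1) (w : E) :
    ‖rad a δ η w‖ = sg a δ η ‖w‖ * ‖w‖ := by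
  unfold rad
  rw [norm_smul, Real.norm_of_nonneg]
  have := sg_ge (a := a) (δ := δ) (r := ‖w‖) hη
  linarith

lemma phi_lt {a δ η : ℝ} (hδ : 0 < δ) (hη : 0 ≤ η) (hη1 : η < 1) {r s : ℝ} (hr : 0 ≤ r)
    (hrs : r < s) : sg a δ η r * r < sg a δ η s * s := by
  have h1 := sg_mono (a := a) hδ hη hrs.le
  have h2 := sg_ge (a := a) (δ := δ) (r := s) hη
  nlinarith

lemma rad_inj {a δ η : ℝ} (hδ : 0 < δ) (hη : 0 ≤ η) (hη1 : η < 1) :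
    Function.Injective (rad a δ η : E → E) := by
  intro w w' h
  have hn : sg a δ η ‖w‖ * ‖w‖ = sg a δ η ‖w'‖ * ‖w'‖ := by
    rw [← norm_rad hη hη1, ← norm_rad hη hη1, h]
  have he : ‖w‖ = ‖w'‖ := by
    rcases lt_trichotomy ‖w‖ ‖w'‖ with h1 | h1 | h1
    · exact absurd hn (phi_lt hδ hη hη1 (norm_nonneg _) h1).ne
    · exact h1
    · exact absurd hn (phi_lt hδ hη hη1 (norm_nonneg _) h1).ne'
  unfold rad at h
  rw [he] at h
  have h2 := sg_ge (a := a) (δ := δ) (r := ‖w'‖) hη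
  exact smul_right_injective E (by linarith : (0:ℝ) < sg a δ η ‖w'‖).ne' h

lemma rad_surj {a δ η : ℝ} (ha : 0 ≤ a) (hδ : 0 < δ) (hη : 0 ≤ η) (hη1 : η < 1) :
    Function.Surjective (rad a δ η : E → E) := by
  intro w
  have hle : (0:ℝ) ≤ ‖w‖ + a + δ := by positivity
  have hc : ContinuousOn (fun r => sg a δ η r * r) (Icc 0 (‖w‖ + a + δ)) :=
    ((sg_cont a δ η).mul continuous_id).continuousOn
  have hmem : ‖w‖ ∈ Icc (sg a δ η 0 * 0) (sg a δ η (‖w‖ + a + δ) * (‖w‖ + a + δ)) := by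
    rw [sg_eq_one (r := ‖w‖ + a + δ) hδ (by linarith [norm_nonneg w])]
    constructor
    · simp
    · linarith
  obtain ⟨r, hr, hrw⟩ := intermediate_value_Icc hle hc hmem
  have h2 : 0 < sg a δ η r := by
    have := sg_ge (a := a) (δ := δ) (r := r) hη
    linarith
  have hn : ‖(sg a δ η r)⁻¹ • w‖ = r := by
    rw [norm_smul, Real.norm_of_nonneg (inv_nonneg.2 h2.le), ← hrw]
    field_simp
  refine ⟨(sg a δ η r)⁻¹ • w, ?_⟩
  unfold rad
  rw [hn, smul_inv_smul₀ h2.ne']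

lemma rad_image {a δ η : ℝ} (hδ : 0 < δ) (hη : 0 ≤ η) (hη1 : η < 1) :
    (rad a δ η : E → E) '' closedBall 0 a = closedBall 0 ((1 - η) * a) := by
  have h1 : 0 < 1 - η := by linarith
  ext w
  simp only [mem_image, mem_closedBall_zero_iff]
  constructor
  · rintro ⟨v, hv, rfl⟩
    rw [norm_rad hη hη1, sg_eq hδ hv]
    gcongr
  · intro hw
    have hn : ‖(1 - η)⁻¹ • w‖ ≤ a := by
      rw [norm_smul, Real.norm_of_nonneg (inv_nonneg.2 h1.le), inv_mul_le_iff₀ h1]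
      exact hw
    refine ⟨(1 - η)⁻¹ • w, hn, ?_⟩
    unfold rad
    rw [sg_eq hδ hn, smul_inv_smul₀ h1.ne']

lemma rad_disp {a δ η : ℝ} (hη : 0 ≤ η) (w : E) :
    dist (rad a δ η w) w ≤ η * ‖w‖ := by
  rw [dist_eq_norm]
  have : rad a δ η w - w = (sg a δ η ‖w‖ - 1) • w := by rw [sub_smul, one_smul]; rfl
  rw [this, norm_smul]
  gcongr
  rw [Real.norm_eq_abs, abs_le]
  have h1 := sg_ge (a := a) (δ := δ) (r := ‖w‖) hη
  have h2 := sg_le_one (a := a) (δ := δ) (r := ‖w‖) hη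
  constructor <;> linarith

lemma rad_eq {a δ η : ℝ} (hδ : 0 < δ) {w : E} (hw : a + δ ≤ ‖w‖) : rad a δ η w = w := by
  unfold rad; rw [sg_eq_one hδ hw, one_smul]

/-- extension of a compactly supported bijection through an open embedding -/
lemma extend_homeo [ProperSpace E] {X : Type*} [TopologicalSpace X] [CompactSpace X] [T2Space X]
    (ψ : E → X) (hψ : IsOpenEmbedding ψ) (ρ : E → E) (hc : Continuous ρ)
    (hb : Function.Bijective ρ) (R : ℝ) (hR : ∀ w, R ≤ ‖w‖ → ρ w = w) :
    ∃ g : X ≃ₜ X, (∀ w, g (ψ w) = ψ (ρ w)) ∧ ∀ x, x ∉ ψ '' closedBall 0 R → g x = x := by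
  set g : X → X := Function.extend ψ (ψ ∘ ρ) id with hg
  have g1 : ∀ w, g (ψ w) = ψ (ρ w) := fun w => hψ.injective.extend_apply _ _ w
  have g2 : ∀ x, x ∉ range ψ → g x = x := fun x hx => Function.extend_apply' _ _ _ hx
  have g3 : ∀ x, x ∉ ψ '' closedBall 0 R → g x = x := by
    intro x hx
    by_cases hr : x ∈ range ψ
    · obtain ⟨w, rfl⟩ := hr
      rw [g1, hR]
      by_contra hlt
      exact hx ⟨w, by simpa using (not_le.1 hlt).le, rfl⟩
    · exact g2 x hr
  have gcont : Continuous g := by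
    rw [continuous_iff_continuousAt]
    intro x
    by_cases hr : x ∈ range ψ
    · obtain ⟨w, rfl⟩ := hr
      rw [← hψ.continuousAt_iff]
      have : g ∘ ψ = ψ ∘ ρ := funext g1
      rw [this]
      exact (hψ.continuous.comp hc).continuousAt
    · have ho : IsOpen (ψ '' closedBall 0 R)ᶜ :=
        ((isCompact_closedBall 0 R).image hψ.continuous).isClosed.isOpen_compl
      have hx : x ∈ (ψ '' closedBall 0 R)ᶜ := fun h => hr (image_subset_range _ _ h)
      have : g =ᶠ[𝓝 x] id := by
        filter_upwards [ho.mem_nhds hx] with y hy using g3 y hy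
      exact continuousAt_id.congr this.symm
  have gb : Function.Bijective g := by
    constructor
    · intro x y hxy
      by_cases hx : x ∈ range ψ <;> by_cases hy : y ∈ range ψ
      · obtain ⟨w, rfl⟩ := hx
        obtain ⟨v, rfl⟩ := hy
        rw [g1, g1] at hxy
        rw [hb.1 (hψ.injective hxy)]
      · obtain ⟨w, rfl⟩ := hx
        rw [g1, g2 y hy] at hxy
        exact absurd ⟨_, hxy⟩ hy
      · obtain ⟨w, rfl⟩ := hy
        rw [g1, g2 x hx] at hxy
        exact absurd ⟨_, hxy.symm⟩ hx
      · rwa [g2 x hx, g2 y hy] at hxy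
    · intro y
      by_cases hy : y ∈ range ψ
      · obtain ⟨w, rfl⟩ := hy
        obtain ⟨v, rfl⟩ := hb.2 w
        exact ⟨ψ v, g1 v⟩
      · exact ⟨y, g2 y hy⟩
  refine ⟨Continuous.homeoOfEquivCompactToT2 (f := Equiv.ofBijective g gb) gcont, g1, g3⟩

end radial

section shrink
variable {X : Type*} [MetricSpace X] [CompactSpace X]

def Null (A : ℕ → Set X) : Prop := ∀ ε > 0, {i | ε < diam (A i)}.Finite

lemma dist_le_diam {A : Set X} {x y : X} (hx : x ∈ A) (hy : y ∈ A) : dist x y ≤ diam A :=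
  Metric.dist_le_diam_of_mem Metric.isBounded_of_compactSpace hx hy

lemma Null.image {A : ℕ → Set X} (hA : Null A) {g : X → X} (hg : Continuous g) :
    Null (fun i => g '' A i) := by
  intro ε hε
  obtain ⟨δ, hδ, h⟩ := Metric.uniformContinuous_iff.1
    (CompactSpace.uniformContinuous_of_continuous hg) ε hε
  refine (hA (δ / 2) (by positivity)).subset ?_
  intro i hi
  simp only [mem_ofPred_eq] at hi ⊢
  by_contra hlt
  refine absurd hi (not_lt.2 ?_)
  refine Metric.diam_le_of_forall_dist_le hε.le ?_
  rintro _ ⟨x, hx, rfl⟩ _ ⟨y, hy, rfl⟩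
  refine (h ?_).le
  have := dist_le_diam hx hy
  linarith

variable {E : Type*} [NormedAddCommGroup E] [NormedSpace ℝ E] [ProperSpace E]

lemma image_trans_homeo {X : Type*} [TopologicalSpace X] (g g' : X ≃ₜ X) (S : Set X) :
    (g.trans g') '' S = g' '' (g '' S) := by
  rw [image_image]; rfl

lemma small_step (A : ℕ → Set X) (hnull : Null A) (hcl : ∀ i, IsClosed (A i))
    (hdis : ∀ i j, i ≠ j → Disjoint (A i) (A j)) (ψ : E → X) (hψ : IsOpenEmbedding ψ)
    (i₀ : ℕ) (a : ℝ) (ha : 0 ≤ a) (ha2 : a ≤ 2) (hA : A i₀ = ψ '' closedBall 0 a)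
    (V : Set X) (hV : IsOpen V) (hAV : A i₀ ⊆ V) (ε : ℝ) (hε : 0 < ε)
    (η : ℝ) (hη : 0 < η) (hη1 : η < 1)
    (hmod : ∀ w w' : E, ‖w‖ ≤ 3 → dist w' w ≤ η * 3 → dist (ψ w') (ψ w) ≤ ε / 3) :
    ∃ g : X ≃ₜ X, (∀ x, x ∉ V → g x = x) ∧ g '' A i₀ = ψ '' closedBall 0 ((1 - η) * a) ∧
      ∀ j, j ≠ i₀ → diam (g '' A j) ≤ max (diam (A j)) ε := by
  have hfin := hnull (ε / 3) (by positivity)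
  set W : Set X := V ∩ ⋂ j ∈ {j | ε / 3 < diam (A j)} \ {i₀}, (A j)ᶜ with hW
  have hWo : IsOpen W := by
    refine hV.inter ?_
    exact (hfin.subset sdiff_subset).isOpen_biInter (fun j _ => (hcl j).isOpen_compl)
  have hAW : A i₀ ⊆ W := by
    refine subset_inter hAV ?_
    refine subset_iInter₂ fun j hj => ?_
    exact (hdis i₀ j (fun h => hj.2 h.symm)).subset_compl_right
  have hsub : closedBall (0 : E) a ⊆ ψ ⁻¹' W := by
    rw [← image_subset_iff, ← hA]; exact hAW
  obtain ⟨δ', hδ', hthick⟩ := (isCompact_closedBall (0 : E) a).exists_cthickening_subset_open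
    (hWo.preimage hψ.continuous) hsub
  rw [cthickening_closedBall hδ'.le ha] at hthick
  set δ := min δ' 1 with hδdef
  have hδ : 0 < δ := lt_min hδ' one_pos
  have hball : ψ '' closedBall 0 (a + δ) ⊆ W := by
    rw [image_subset_iff]
    refine (closedBall_subset_closedBall ?_).trans hthick
    have := min_le_left δ' 1
    linarith
  obtain ⟨g, hg1, hg2⟩ := extend_homeo ψ hψ (rad a δ η) (rad_cont _ _ _)
    ⟨rad_inj hδ hη.le hη1, rad_surj ha hδ hη.le hη1⟩ (a + δ) (fun w hw => rad_eq hδ hw)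
  have hdisp : ∀ x, dist (g x) x ≤ ε / 3 := by
    intro x
    by_cases hx : x ∈ ψ '' closedBall 0 (a + δ)
    · obtain ⟨w, hw, rfl⟩ := hx
      rw [mem_closedBall_zero_iff] at hw
      have hw3 : ‖w‖ ≤ 3 := by
        have := min_le_right δ' 1
        linarith
      rw [hg1]
      refine hmod _ _ hw3 ((rad_disp hη.le w).trans ?_)
      gcongr
    · rw [hg2 x hx, dist_self]; positivity
  refine ⟨g, ?_, ?_, ?_⟩
  · intro x hx
    exact hg2 x (fun h => hx (hball h).1)
  · rw [hA, image_image]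
    simp only [hg1]
    rw [← rad_image hδ hη.le hη1, image_image]
  · intro j hj
    by_cases hjb : ε / 3 < diam (A j)
    · have : g '' A j = A j := by
        have : ∀ x ∈ A j, g x = x := by
          intro x hx
          refine hg2 x fun h => ?_
          have := (hball h).2
          rw [mem_iInter₂] at this
          exact this j ⟨hjb, hj⟩ hx
        rw [image_congr this, image_id']
      rw [this]; exact le_max_left _ _
    · refine le_max_of_le_right ?_
      refine Metric.diam_le_of_forall_dist_le hε.le ?_
      rintro _ ⟨x, hx, rfl⟩ _ ⟨y, hy, rfl⟩
      have h1 := dist_le_diam hx hy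
      have h2 := dist_triangle4 (g x) x y (g y)
      have h3 := hdisp x
      have h4 := hdisp y
      rw [dist_comm] at h4
      linarith

lemma one_cell (A : ℕ → Set X) (hnull : Null A) (hcl : ∀ i, IsClosed (A i))
    (hdis : ∀ i j, i ≠ j → Disjoint (A i) (A j)) (ψ : E → X) (hψ : IsOpenEmbedding ψ)
    (i₀ : ℕ) (hA : A i₀ = ψ '' closedBall 0 2)
    (V : Set X) (hV : IsOpen V) (hAV : A i₀ ⊆ V) (ε : ℝ) (hε : 0 < ε) :
    ∃ g : X ≃ₜ X, (∀ x, x ∉ V → g x = x) ∧ diam (g '' A i₀) ≤ ε ∧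
      ∀ j, diam (g '' A j) ≤ max (diam (A j)) ε := by
  -- modulus
  obtain ⟨δ, hδ, hδu⟩ := Metric.uniformContinuousOn_iff.1
    ((isCompact_closedBall (0 : E) 6).uniformContinuousOn_of_continuous
      hψ.continuous.continuousOn) (ε / 3) (by positivity)
  set η : ℝ := min (δ / 6) (1 / 2) with hηd
  have hη : 0 < η := lt_min (by positivity) (by norm_num)
  have hη1 : η < 1 := (min_le_right _ _).trans_lt (by norm_num)
  have hmod : ∀ w w' : E, ‖w‖ ≤ 3 → dist w' w ≤ η * 3 → dist (ψ w') (ψ w) ≤ ε / 3 := by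
    intro w w' hw hd
    have h1 : η ≤ δ / 6 := min_le_left _ _
    have h2 : η ≤ 1 / 2 := min_le_right _ _
    refine (hδu w' ?_ w ?_ ?_).le
    · rw [mem_closedBall]
      have := dist_triangle w' w 0
      rw [dist_zero_right w] at this
      linarith
    · rw [mem_closedBall_zero_iff]; linarith
    · linarith
  have key : ∀ k : ℕ, ∃ g : X ≃ₜ X, (∀ x, x ∉ V → g x = x) ∧
      g '' A i₀ = ψ '' closedBall 0 ((1 - η) ^ k * 2) ∧
      ∀ j, j ≠ i₀ → diam (g '' A j) ≤ max (diam (A j)) ε := by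
    intro k
    induction k with
    | zero =>
      refine ⟨Homeomorph.refl X, fun x _ => rfl, ?_, fun j _ => ?_⟩
      · simp [hA]
      · simp
    | succ k ih =>
      obtain ⟨g, h1, h2, h3⟩ := ih
      have hp : (1 - η) ^ k ≤ 1 := pow_le_one₀ (by linarith) (by linarith)
      have hp0 : 0 ≤ (1 - η) ^ k := pow_nonneg (by linarith) _
      have hgV : g '' A i₀ ⊆ V := by
        rintro _ ⟨x, hx, rfl⟩
        by_contra hgx
        have := h1 _ hgx
        rw [g.injective this] at hgx
        exact hgx (hAV hx)
      obtain ⟨g', h1', h2', h3'⟩ := small_step (fun i => g '' A i) (hnull.image g.continuous)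
        (fun i => g.isClosedMap _ (hcl i))
        (fun i j hij => (disjoint_image_iff g.injective).2 (hdis i j hij)) ψ hψ i₀
        ((1 - η) ^ k * 2) (by positivity) (by linarith) h2 V hV hgV ε hε η hη hη1 hmod
      refine ⟨g.trans g', ?_, ?_, ?_⟩
      · intro x hx
        simp only [Homeomorph.trans_apply]
        rw [h1 x hx, h1' x hx]
      · rw [image_trans_homeo, h2']
        congr 2; ring
      · intro j hj
        rw [image_trans_homeo]
        exact (h3' j hj).trans (max_le (h3 j hj) (le_max_right _ _))
  have hlim : Tendsto (fun k : ℕ => (1 - η) ^ k * 2) atTop (𝓝 (0 * 2)) :=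
    (tendsto_pow_atTop_nhds_zero_of_lt_one (by linarith) (by linarith)).mul_const 2
  rw [zero_mul] at hlim
  obtain ⟨k, hk⟩ := (hlim.eventually (gt_mem_nhds (show (0:ℝ) < min (δ / 2) 6 by positivity))).exists
  have hk1 : (1 - η) ^ k * 2 < δ / 2 := hk.trans_le (min_le_left _ _)
  have hk2 : (1 - η) ^ k * 2 < 6 := hk.trans_le (min_le_right _ _)
  obtain ⟨g, h1, h2, h3⟩ := key k
  have hi : diam (g '' A i₀) ≤ ε := by
    rw [h2]
    refine Metric.diam_le_of_forall_dist_le hε.le ?_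
    rintro _ ⟨x, hx, rfl⟩ _ ⟨y, hy, rfl⟩
    have hx' := hx
    have hy' := hy
    rw [mem_closedBall] at hx' hy'
    have := hδu x (closedBall_subset_closedBall hk2.le hx) y
      (closedBall_subset_closedBall hk2.le hy) (by
        have := dist_triangle_right x y 0
        linarith)
    linarith
  refine ⟨g, h1, hi, fun j => ?_⟩
  by_cases hj : j = i₀
  · rw [hj]; exact hi.trans (le_max_right _ _)
  · exact h3 j hj

/-- `A` is the image of the ball of radius two under an open embedding of `E` -/
def Std (E : Type*) [NormedAddCommGroup E] (A : Set X) : Prop :=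
  ∃ ψ : E → X, IsOpenEmbedding ψ ∧ A = ψ '' closedBall 0 2

lemma Std.image {A : Set X} (h : Std E A) (g : X ≃ₜ X) : Std E (g '' A) := by
  obtain ⟨ψ, h1, rfl⟩ := h
  exact ⟨g ∘ ψ, g.isOpenEmbedding.comp h1, by rw [image_comp]⟩

lemma Std.isClosed {A : Set X} (h : Std E A) : IsClosed A := by
  obtain ⟨ψ, h1, rfl⟩ := h
  exact ((isCompact_closedBall _ _).image h1.continuous).isClosed

lemma finite_cells (A : ℕ → Set X) (hnull : Null A) (hstd : ∀ i, Std E (A i))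
    (hdis : ∀ i j, i ≠ j → Disjoint (A i) (A j)) (ε : ℝ) (hε : 0 < ε)
    (V : ℕ → Set X) (hV : ∀ i, IsOpen (V i)) (hAV : ∀ i, A i ⊆ V i) (F : Finset ℕ)
    (hVd : ∀ i ∈ F, ∀ j ∈ F, i ≠ j → Disjoint (V i) (V j)) :
    ∃ g : X ≃ₜ X, (∀ x, g x = x ∨ ∃ i ∈ F, x ∈ V i ∧ g x ∈ V i) ∧
      (∀ i ∈ F, diam (g '' A i) ≤ ε) ∧ ∀ j, diam (g '' A j) ≤ max (diam (A j)) ε := by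
  classical
  induction F using Finset.induction_on with
  | empty => exact ⟨Homeomorph.refl X, fun x => Or.inl rfl, by simp, by simp⟩
  | insert a F haF ih =>
    obtain ⟨g, h1, h2, h3⟩ := ih (fun i hi j hj => hVd i (Finset.mem_insert_of_mem hi) j
      (Finset.mem_insert_of_mem hj))
    have hda : ∀ i ∈ F, Disjoint (V i) (V a) := fun i hi =>
      hVd i (Finset.mem_insert_of_mem hi) a (Finset.mem_insert_self _ _)
        (fun h => haF (h ▸ hi))
    have hga : ∀ x ∈ V a, g x = x := by
      intro x hx
      rcases h1 x with h | ⟨i, hi, hxi, _⟩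
      · exact h
      · exact absurd hx (disjoint_left.1 (hda i hi) hxi)
    have hgA : g '' A a ⊆ V a := by
      rintro _ ⟨x, hx, rfl⟩
      rw [hga x (hAV a hx)]; exact hAV a hx
    obtain ⟨ψ, hψ, hψA⟩ := (hstd a).image g
    obtain ⟨g', h1', h2', h3'⟩ := one_cell (fun i => g '' A i) (hnull.image g.continuous)
        (fun i => g.isClosedMap _ (hstd i).isClosed)
        (fun i j hij => (disjoint_image_iff g.injective).2 (hdis i j hij)) ψ hψ a
        hψA (V a) (hV a) hgA ε hε
    have hg'V : ∀ x ∈ V a, g' x ∈ V a := by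
      intro x hx
      by_contra hgx
      have := h1' _ hgx
      rw [g'.injective this] at hgx
      exact hgx hx
    refine ⟨g.trans g', ?_, ?_, ?_⟩
    · intro x
      simp only [Homeomorph.trans_apply]
      by_cases hx : x ∈ V a
      · right
        refine ⟨a, Finset.mem_insert_self _ _, hx, ?_⟩
        rw [hga x hx]; exact hg'V x hx
      · rcases h1 x with h | ⟨i, hi, hxi, hgi⟩
        · left; rw [h, h1' x hx]
        · right
          refine ⟨i, Finset.mem_insert_of_mem hi, hxi, ?_⟩
          rw [h1' _ (disjoint_left.1 (hda i hi) hgi)]; exact hgi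
    · intro i hi
      rw [image_trans_homeo]
      rcases Finset.mem_insert.1 hi with rfl | hi
      · exact h2'
      · exact (h3' i).trans (max_le (h2 i hi) le_rfl)
    · intro j
      rw [image_trans_homeo]
      exact (h3' j).trans (max_le (h3 j) (le_max_right _ _))

lemma bing_step {Y : Type*} [MetricSpace Y] (A : ℕ → Set X) (hnull : Null A)
    (hstd : ∀ i, Std E (A i))
    (hdis : ∀ i j, i ≠ j → Disjoint (A i) (A j)) (U : Set X) (hU : IsOpen U)
    (hAU : ∀ i, A i ⊆ U) (π : X → Y) (hπ : Continuous π)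
    (hπA : ∀ i, ∀ x ∈ A i, ∀ y ∈ A i, π x = π y) (D : ℝ) (hD0 : 0 ≤ D)
    (hD : ∀ i, diam (A i) ≤ D) (ε : ℝ) (hε : 0 < ε) :
    ∃ g : X ≃ₜ X, (∀ x, x ∉ U → g x = x) ∧ (∀ i, diam (g '' A i) ≤ ε) ∧
      (∀ x, dist (g x) x ≤ D + ε) ∧ ∀ x, dist (π (g x)) (π x) ≤ ε := by
  have hfin := hnull ε hε
  set F := hfin.toFinset with hF
  have hcomp : ∀ i, IsCompact (A i) := fun i => (hstd i).isClosed.isCompact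
  -- per-cell condition
  have e1 : ∀ i, ∀ᶠ δ in 𝓝[>] (0:ℝ), thickening δ (A i) ⊆ U ∧
      ∀ x ∈ thickening δ (A i), ∀ y ∈ thickening δ (A i), dist (π x) (π y) ≤ ε := by
    intro i
    rcases (A i).eq_empty_or_nonempty with hemp | ⟨b, hb⟩
    · filter_upwards with δ
      simp [hemp]
    have hO : IsOpen (U ∩ π ⁻¹' ball (π b) (ε / 2)) := hU.inter (isOpen_ball.preimage hπ)
    have hsub : A i ⊆ U ∩ π ⁻¹' ball (π b) (ε / 2) := by
      refine subset_inter (hAU i) fun x hx => ?_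
      rw [mem_preimage, hπA i x hx b hb]
      exact mem_ball_self (by positivity)
    obtain ⟨δ₀, hδ₀, h⟩ := (hcomp i).exists_thickening_subset_open hO hsub
    filter_upwards [Ioo_mem_nhdsGT hδ₀] with δ hδ
    have h' := (thickening_mono hδ.2.le (A i)).trans h
    refine ⟨fun x hx => (h' hx).1, fun x hx y hy => ?_⟩
    have h1 := (h' hx).2
    have h2 := (h' hy).2
    rw [mem_preimage, mem_ball] at h1 h2
    have := dist_triangle_right (π x) (π y) (π b)
    linarith
  have e2 : ∀ i j, ∀ᶠ δ in 𝓝[>] (0:ℝ), i ≠ j →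
      Disjoint (thickening δ (A i)) (thickening δ (A j)) := by
    intro i j
    by_cases hij : i = j
    · filter_upwards with δ h using absurd hij h
    obtain ⟨δ₀, hδ₀, h⟩ := (hdis i j hij).exists_thickenings (hcomp i) (hstd j).isClosed
    filter_upwards [Ioo_mem_nhdsGT hδ₀] with δ hδ _
    exact h.mono (thickening_mono hδ.2.le _) (thickening_mono hδ.2.le _)
  have e3 : ∀ᶠ δ in 𝓝[>] (0:ℝ), δ ∈ Ioo 0 (ε / 2) := Ioo_mem_nhdsGT (by positivity)
  obtain ⟨δ, h1, h2, h3⟩ := (((F.eventually_all).2 (fun i _ => e1 i)).and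
    ((((F.eventually_all).2 (fun i _ => (F.eventually_all).2 (fun j _ => e2 i j)))).and e3)).exists
  obtain ⟨g, g1, g2, g3⟩ := finite_cells (E := E) A hnull hstd hdis ε hε
    (fun i => thickening δ (A i))
    (fun i => isOpen_thickening) (fun i => self_subset_thickening h3.1 _) F
    (fun i hi j hj => h2 i hi j hj)
  refine ⟨g, ?_, ?_, ?_, ?_⟩
  · intro x hx
    rcases g1 x with h | ⟨i, hi, hxi, _⟩
    · exact h
    · exact absurd ((h1 i hi).1 hxi) hx
  · intro i
    by_cases hi : i ∈ F
    · exact g2 i hi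
    · have : diam (A i) ≤ ε := by simpa [hF] using hi
      exact (g3 i).trans (max_le this le_rfl)
  · intro x
    rcases g1 x with h | ⟨i, hi, hxi, hgi⟩
    · rw [h, dist_self]; positivity
    · obtain ⟨y, hy, hxy⟩ := mem_thickening_iff.1 hxi
      obtain ⟨z, hz, hgz⟩ := mem_thickening_iff.1 hgi
      have := dist_triangle4 (g x) z y x
      have h4 := (dist_le_diam hz hy).trans (hD i)
      rw [dist_comm y x] at this
      linarith [h3.2]
  · intro x
    rcases g1 x with h | ⟨i, hi, hxi, hgi⟩
    · rw [h, dist_self]; positivity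
    · exact (h1 i hi).2 _ hgi _ hxi

end shrink

section quotient
variable {X : Type*} [MetricSpace X] [CompactSpace X]

/-- the equivalence relation of the decomposition -/
def decSetoid (A : ℕ → Set X) (hdis : ∀ i j, i ≠ j → Disjoint (A i) (A j)) : Setoid X where
  r x y := x = y ∨ ∃ i, x ∈ A i ∧ y ∈ A i
  iseqv := by
    refine ⟨fun x => Or.inl rfl, ?_, ?_⟩
    · rintro x y (rfl | ⟨i, h1, h2⟩)
      · exact Or.inl rfl
      · exact Or.inr ⟨i, h2, h1⟩
    · rintro x y z (rfl | ⟨i, h1, h2⟩) (rfl | ⟨j, h3, h4⟩)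
      · exact Or.inl rfl
      · exact Or.inr ⟨j, h3, h4⟩
      · exact Or.inr ⟨i, h1, h2⟩
      · have : i = j := by
          by_contra hij
          exact disjoint_left.1 (hdis i j hij) h2 h3
        subst this
        exact Or.inr ⟨i, h1, h4⟩

/-- the saturation of a closed set is closed -/
lemma sat_closed (A : ℕ → Set X) (hnull : Null A) (hcl : ∀ i, IsClosed (A i))
    (C : Set X) (hC : IsClosed C) :
    IsClosed {x | x ∈ C ∨ ∃ i, x ∈ A i ∧ (A i ∩ C).Nonempty} := by
  rw [← isOpen_compl_iff, Metric.isOpen_iff]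
  intro x hx
  have hx1 : x ∉ C := fun h => hx (Or.inl h)
  have hx2 : ∀ i, (A i ∩ C).Nonempty → x ∉ A i := fun i h h' => hx (Or.inr ⟨i, h', h⟩)
  obtain ⟨r, hr, hrC⟩ := Metric.isOpen_iff.1 hC.isOpen_compl x hx1
  have hfin := hnull (r / 2) (by positivity)
  have ho : IsOpen (⋂ j ∈ {j | r / 2 < diam (A j)} ∩ {j | (A j ∩ C).Nonempty}, (A j)ᶜ) :=
    (hfin.subset inter_subset_left).isOpen_biInter (fun j _ => (hcl j).isOpen_compl)
  have hxm : x ∈ ⋂ j ∈ {j | r / 2 < diam (A j)} ∩ {j | (A j ∩ C).Nonempty}, (A j)ᶜ :=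
    mem_iInter₂.2 fun j hj => hx2 j hj.2
  obtain ⟨s, hs, hsO⟩ := Metric.isOpen_iff.1 ho x hxm
  refine ⟨min s (r / 2), by positivity, ?_⟩
  intro y hy
  have hys : y ∈ ball x s := ball_subset_ball (min_le_left _ _) hy
  have hyr : dist y x < r / 2 := lt_of_lt_of_le hy (min_le_right _ _)
  rintro (h | ⟨i, hyi, z, hzi, hzC⟩)
  · exact hrC (show y ∈ ball x r by rw [mem_ball]; linarith) h
  · by_cases hd : r / 2 < diam (A i)
    · exact mem_iInter₂.1 (hsO hys) i ⟨hd, ⟨z, hzi, hzC⟩⟩ hyi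
    · refine hrC (show z ∈ ball x r from ?_) hzC
      rw [mem_ball]
      have := dist_le_diam hzi hyi
      have := dist_triangle z y x
      linarith

lemma quot_t2 (A : ℕ → Set X) (hnull : Null A) (hcl : ∀ i, IsClosed (A i))
    (hdis : ∀ i j, i ≠ j → Disjoint (A i) (A j)) : T2Space (Quotient (decSetoid A hdis)) := by
  set S := decSetoid A hdis with hS
  have hr : ∀ x y : X, (Quotient.mk S x = Quotient.mk S y) ↔ (x = y ∨ ∃ i, x ∈ A i ∧ y ∈ A i) :=
    fun x y => Quotient.eq (r := S)
  have hclass : ∀ x : X, IsClosed {y | Quotient.mk S y = Quotient.mk S x} := by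
    intro x
    convert sat_closed A hnull hcl {x} isClosed_singleton using 1
    ext y
    simp only [mem_ofPred_eq, hr, mem_singleton_iff, inter_singleton_nonempty]
  -- open saturated kernel
  have hker : ∀ O : Set X, IsOpen O →
      IsOpen {q : Quotient S | ∀ y, Quotient.mk S y = q → y ∈ O} := by
    intro O hO
    rw [← isQuotientMap_quotient_mk'.isOpen_preimage, ← isClosed_compl_iff]
    convert sat_closed A hnull hcl Oᶜ hO.isClosed_compl using 1
    ext x
    simp only [mem_compl_iff, mem_preimage, mem_ofPred_eq, not_forall, exists_prop]
    constructor
    · rintro ⟨y, hyx, hyO⟩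
      rcases (hr y x).1 hyx with rfl | ⟨i, h1, h2⟩
      · exact Or.inl hyO
      · exact Or.inr ⟨i, h2, y, h1, hyO⟩
    · rintro (h | ⟨i, hxi, y, hyi, hyO⟩)
      · exact ⟨x, rfl, h⟩
      · exact ⟨y, (hr y x).2 (Or.inr ⟨i, hyi, hxi⟩), hyO⟩
  refine ⟨fun p q hpq => ?_⟩
  induction p using Quotient.inductionOn with | _ x
  induction q using Quotient.inductionOn with | _ y
  have hd : Disjoint {z | Quotient.mk S z = Quotient.mk S x}
      {z | Quotient.mk S z = Quotient.mk S y} := by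
    rw [disjoint_left]
    intro z h1 h2
    exact hpq (h1.symm.trans h2)
  obtain ⟨O₁, O₂, ho1, ho2, hs1, hs2, hO⟩ := normal_separation (hclass x) (hclass y) hd
  refine ⟨_, _, hker O₁ ho1, hker O₂ ho2, fun z hz => hs1 hz, fun z hz => hs2 hz, ?_⟩
  rw [disjoint_left]
  intro q h1 h2
  induction q using Quotient.inductionOn with | _ z
  exact disjoint_left.1 hO (h1 z rfl) (h2 z rfl)

/-- a map to `ℕ → ℝ` whose fibres are exactly the elements of the decomposition -/
lemma exists_proj (A : ℕ → Set X) (hnull : Null A) (hcl : ∀ i, IsClosed (A i))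
    (hdis : ∀ i j, i ≠ j → Disjoint (A i) (A j)) :
    ∃ π : X → (ℕ → ℝ), Continuous π ∧ (∀ i, ∀ x ∈ A i, ∀ y ∈ A i, π x = π y) ∧
      ∀ x y, π x = π y → x = y ∨ ∃ i, x ∈ A i ∧ y ∈ A i := by
  haveI := quot_t2 A hnull hcl hdis
  set S := decSetoid A hdis with hS
  have hr : ∀ x y : X, (Quotient.mk S x = Quotient.mk S y) ↔ (x = y ∨ ∃ i, x ∈ A i ∧ y ∈ A i) :=
    fun x y => Quotient.eq (r := S)
  let T : Set C(X, ℝ) := {u | ∀ i, ∀ x ∈ A i, ∀ y ∈ A i, u x = u y}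
  haveI : Nonempty T := ⟨⟨0, fun i x _ y _ => rfl⟩⟩
  let u : ℕ → T := TopologicalSpace.denseSeq T
  refine ⟨fun x k => (u k : C(X, ℝ)) x, ?_, ?_, ?_⟩
  · exact continuous_pi fun k => (u k : C(X, ℝ)).continuous
  · intro i x hx y hy
    funext k
    exact (u k).2 i x hx y hy
  · intro x y hxy
    by_contra hne
    rw [← hr] at hne
    obtain ⟨f, hf0, hf1, -⟩ := exists_continuous_zero_one_of_isClosed
      (isClosed_singleton (x := Quotient.mk S x)) (isClosed_singleton (x := Quotient.mk S y))
      (by simpa using hne)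
    let v : T := ⟨f.comp ⟨Quotient.mk S, continuous_quotient_mk'⟩, by
      intro i a ha b hb
      simp only [ContinuousMap.comp_apply, ContinuousMap.coe_mk]
      rw [(hr a b).2 (Or.inr ⟨i, ha, hb⟩)]⟩
    have hv0 : (v : C(X, ℝ)) x = 0 := hf0 rfl
    have hv1 : (v : C(X, ℝ)) y = 1 := hf1 rfl
    obtain ⟨k, hk⟩ := (TopologicalSpace.denseRange_denseSeq T).exists_dist_lt v
      (show (0:ℝ) < 1 / 3 by norm_num)
    have h1 : dist ((v : C(X, ℝ)) x) ((u k : C(X, ℝ)) x) < 1 / 3 :=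
      (ContinuousMap.dist_apply_le_dist x).trans_lt hk
    have h2 : dist ((v : C(X, ℝ)) y) ((u k : C(X, ℝ)) y) < 1 / 3 :=
      (ContinuousMap.dist_apply_le_dist y).trans_lt hk
    have h3 : (u k : C(X, ℝ)) x = (u k : C(X, ℝ)) y := congrFun hxy k
    rw [hv0, h3, Real.dist_eq, abs_lt] at h1
    rw [hv1, Real.dist_eq, abs_lt] at h2
    linarith [h1.1, h1.2, h2.1, h2.2]

end quotient

section main
variable {X : Type*} [MetricSpace X] [CompactSpace X]
variable {E : Type*} [NormedAddCommGroup E] [NormedSpace ℝ E] [ProperSpace E]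

lemma main_limit {Y : Type*} [MetricSpace Y] [CompleteSpace Y] (A : ℕ → Set X) (hnull : Null A)
    (hstd : ∀ i, Std E (A i))
    (hdis : ∀ i j, i ≠ j → Disjoint (A i) (A j)) (U : Set X) (hU : IsOpen U)
    (hAU : ∀ i, A i ⊆ U) (π : X → Y) (hπ : Continuous π)
    (hπA : ∀ i, ∀ x ∈ A i, ∀ y ∈ A i, π x = π y) :
    ∃ f : X → X, Continuous f ∧ Function.Surjective f ∧ (∀ x, x ∉ U → f x = x) ∧
      (∀ i, ∀ x ∈ A i, ∀ y ∈ A i, f x = f y) ∧ ∀ x y, f x = f y → π x = π y := by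
  set D : ℝ := diam (univ : Set X) + 1 with hDdef
  have hD : 0 < D := by
    have : 0 ≤ diam (univ : Set X) := diam_nonneg
    linarith
  let P : ℕ → (X ≃ₜ X) → Prop := fun k θ =>
    (∀ x, x ∉ U → θ x = x) ∧ ∀ i, diam (θ '' A i) ≤ D * (1 / 2) ^ k
  have step : ∀ k (θ : {θ // P k θ}), ∃ θ' : {θ // P (k + 1) θ},
      (∀ x, dist (θ.1 x) (θ'.1 x) ≤ (2 * D) * (1 / 2) ^ k) ∧
      ∀ x, dist (π (θ.1.symm x)) (π (θ'.1.symm x)) ≤ (2 * D) * (1 / 2) ^ k := by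
    rintro k ⟨θ, hθ1, hθ2⟩
    have hpos : 0 < D * (1 / 2) ^ (k + 1) := by positivity
    have hpos' : 0 < D * (1 / 2) ^ k := by positivity
    have hhalf : D * (1 / 2) ^ (k + 1) = D * (1 / 2) ^ k / 2 := by rw [pow_succ]; ring
    have hθU : ∀ i, θ '' A i ⊆ U := by
      rintro i _ ⟨x, hx, rfl⟩
      by_contra h
      have := hθ1 _ h
      rw [θ.injective this] at h
      exact h (hAU i hx)
    obtain ⟨g, g1, g2, g3, g4⟩ := bing_step (E := E) (fun i => θ '' A i)
      (hnull.image θ.continuous)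
      (fun i => (hstd i).image θ)
      (fun i j hij => (disjoint_image_iff θ.injective).2 (hdis i j hij)) U hU hθU
      (fun x => π (θ.symm x)) (hπ.comp θ.symm.continuous)
      (by
        rintro i _ ⟨x, hx, rfl⟩ _ ⟨y, hy, rfl⟩
        simpa using hπA i x hx y hy)
      (D * (1 / 2) ^ k) hpos'.le hθ2 (D * (1 / 2) ^ (k + 1)) hpos
    refine ⟨⟨θ.trans g, ?_, ?_⟩, ?_, ?_⟩
    · intro x hx
      rw [Homeomorph.trans_apply, hθ1 x hx, g1 x hx]
    · intro i
      rw [image_trans_homeo]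
      exact g2 i
    · intro x
      rw [Homeomorph.trans_apply, dist_comm]
      have := g3 (θ x)
      linarith
    · intro x
      have := g4 (g.symm x)
      simp only [Homeomorph.apply_symm_apply] at this
      refine this.trans ?_
      linarith
  choose nxt hn1 hn2 using step
  let seq : ∀ k, {θ // P k θ} := fun k => Nat.rec
    ⟨Homeomorph.refl X, fun x _ => rfl, fun i => by
      have : diam (⇑(Homeomorph.refl X) '' A i) ≤ diam (univ : Set X) :=
        diam_mono (subset_univ _) Metric.isBounded_of_compactSpace
      simp only [pow_zero, mul_one]
      linarith⟩ (fun k θ => nxt k θ) k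
  have hs1 : ∀ x k, dist ((seq k).1 x) ((seq (k + 1)).1 x) ≤ (2 * D) * (1 / 2) ^ k :=
    fun x k => hn1 k (seq k) x
  have hs2 : ∀ x k, dist (π ((seq k).1.symm x)) (π ((seq (k + 1)).1.symm x)) ≤
      (2 * D) * (1 / 2) ^ k := fun x k => hn2 k (seq k) x
  have hhalf : (1 / 2 : ℝ) < 1 := by norm_num
  have hlim : Tendsto (fun k : ℕ => 2 * D * (1 / 2 : ℝ) ^ k / (1 - 1 / 2)) atTop (𝓝 0) := by
    have := ((tendsto_pow_atTop_nhds_zero_of_lt_one (by norm_num) hhalf).const_mul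
      (2 * D)).div_const (1 - 1 / 2 : ℝ)
    simpa using this
  choose f hf using fun x => cauchySeq_tendsto_of_complete
    (cauchySeq_of_le_geometric (1 / 2) (2 * D) hhalf (hs1 x))
  choose q hq using fun x => cauchySeq_tendsto_of_complete
    (cauchySeq_of_le_geometric (1 / 2) (2 * D) hhalf (hs2 x))
  have hfd := fun x k => dist_le_of_le_geometric_of_tendsto (1 / 2) (2 * D) hhalf (hs1 x) (hf x) k
  have hqd := fun x k => dist_le_of_le_geometric_of_tendsto (1 / 2) (2 * D) hhalf (hs2 x) (hq x) k
  have hfu : TendstoUniformly (fun k x => (seq k).1 x) f atTop := by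
    rw [Metric.tendstoUniformly_iff]
    intro ε hε
    filter_upwards [hlim.eventually (gt_mem_nhds hε)] with k hk x
    rw [dist_comm]
    exact (hfd x k).trans_lt hk
  have hqu : TendstoUniformly (fun k x => π ((seq k).1.symm x)) q atTop := by
    rw [Metric.tendstoUniformly_iff]
    intro ε hε
    filter_upwards [hlim.eventually (gt_mem_nhds hε)] with k hk x
    rw [dist_comm]
    exact (hqd x k).trans_lt hk
  have hfc : Continuous f :=
    hfu.continuous (Eventually.of_forall fun k => (seq k).1.continuous).frequently
  have hqc : Continuous q := hqu.continuous
    (Eventually.of_forall fun k => hπ.comp (seq k).1.symm.continuous).frequently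
  have hqf : ∀ x, q (f x) = π x := by
    intro x
    have h1 := hqu.tendsto_comp hqc.continuousAt (hf x)
    simp only [Homeomorph.symm_apply_apply] at h1
    exact tendsto_nhds_unique h1 tendsto_const_nhds
  refine ⟨f, hfc, ?_, ?_, ?_, ?_⟩
  · intro y
    have hcl : IsClosed (range f) := (isCompact_range hfc).isClosed
    have : y ∈ closure (range f) := by
      rw [Metric.mem_closure_iff]
      intro ε hε
      obtain ⟨k, hk⟩ := (hlim.eventually (gt_mem_nhds hε)).exists
      refine ⟨f ((seq k).1.symm y), mem_range_self _, ?_⟩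
      have := hfd ((seq k).1.symm y) k
      rw [Homeomorph.apply_symm_apply] at this
      exact this.trans_lt hk
    rwa [hcl.closure_eq] at this
  · intro x hx
    refine tendsto_nhds_unique (hf x) ?_
    have : (fun k => (seq k).1 x) = fun _ => x := funext fun k => (seq k).2.1 x hx
    rw [this]
    exact tendsto_const_nhds
  · intro i x hx y hy
    refine eq_of_dist_eq_zero ?_
    have h1 : Tendsto (fun k => dist ((seq k).1 x) ((seq k).1 y)) atTop (𝓝 (dist (f x) (f y))) :=
      (hf x).dist (hf y)
    refine tendsto_nhds_unique h1 ?_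
    have h2 : Tendsto (fun k : ℕ => D * (1 / 2 : ℝ) ^ k) atTop (𝓝 0) := by
      simpa using (tendsto_pow_atTop_nhds_zero_of_lt_one (by norm_num) hhalf).const_mul D
    refine squeeze_zero (fun _ => dist_nonneg) (fun k => ?_) h2
    exact (dist_le_diam (mem_image_of_mem _ hx) (mem_image_of_mem _ hy)).trans ((seq k).2.2 i)
  · intro x y hxy
    rw [← hqf x, ← hqf y, hxy]

lemma main_abstract (A : ℕ → Set X) (hnull : Null A)
    (hstd : ∀ i, Std E (A i))
    (hdis : ∀ i j, i ≠ j → Disjoint (A i) (A j)) (U : Set X) (hU : IsOpen U)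
    (hAU : ∀ i, A i ⊆ U) :
    ∃ f : X → X, Continuous f ∧ Function.Surjective f ∧ (∀ x, x ∉ U → f x = x) ∧
      ∃ p : ℕ → X, (∀ i, p i ∈ U) ∧ (∀ i, f ⁻¹' {p i} = A i) ∧
        Set.BijOn f {x | ∀ i, x ∉ A i} {y | ∀ i, y ≠ p i} := by
  obtain ⟨π, hπ, hπA, hπf⟩ := exists_proj A hnull (fun i => (hstd i).isClosed) hdis
  letI := TopologicalSpace.upgradeIsCompletelyMetrizable (ℕ → ℝ)
  obtain ⟨f, hfc, hfs, hfU, hfA, hfi⟩ := main_limit (E := E) A hnull hstd hdis U hU hAU π hπ hπA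
  have hne : ∀ i, (A i).Nonempty := by
    intro i
    obtain ⟨ψ, -, h⟩ := hstd i
    rw [h]
    exact (nonempty_closedBall.2 (by norm_num)).image ψ
  choose b hb using hne
  have hpre : ∀ i x, f x = f (b i) ↔ x ∈ A i := by
    intro i x
    constructor
    · intro h
      rcases hπf _ _ (hfi _ _ h) with rfl | ⟨j, hj1, hj2⟩
      · exact hb i
      · have : j = i := by
          by_contra hij
          exact disjoint_left.1 (hdis j i hij) hj2 (hb i)
        rwa [← this]
    · intro h
      exact hfA i _ h _ (hb i)
  refine ⟨f, hfc, hfs, hfU, fun i => f (b i), ?_, ?_, ?_, ?_, ?_⟩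
  · intro i
    by_contra h
    exact h (hAU i ((hpre i _).1 (hfU _ h)))
  · intro i
    ext x
    simp [hpre]
  · intro x hx i h
    exact hx i ((hpre i x).1 h)
  · intro x hx y hy h
    rcases hπf _ _ (hfi _ _ h) with h | ⟨j, hj1, -⟩
    · exact h
    · exact absurd hj1 (hx j)
  · intro y hy
    obtain ⟨x, rfl⟩ := hfs y
    exact ⟨x, fun i hi => hy i ((hpre i x).2 hi), rfl⟩

end main

section sphere

lemma hemisphere_std (n : ℕ) (v : EuclideanSpace ℝ (Fin (n + 1))) (hv : ‖v‖ = 1)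
    (hvdef : v = EuclideanSpace.single (Fin.last n) (1 : ℝ)) :
    ({x : sphere (0 : EuclideanSpace ℝ (Fin (n + 1))) 1 |
      (x : EuclideanSpace ℝ (Fin (n + 1))) (Fin.last n) ≤ 0}) =
      (stereographic hv).symm '' closedBall 0 2 := by
  have hco : ∀ x : EuclideanSpace ℝ (Fin (n + 1)), x (Fin.last n) = inner ℝ v x := by
    intro x
    rw [hvdef, EuclideanSpace.inner_single_left]; simp
  have hval : ∀ w : (Submodule.span ℝ {v})ᗮ,
      (((stereographic hv).symm w : sphere (0 : EuclideanSpace ℝ (Fin (n + 1))) 1) :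
        EuclideanSpace ℝ (Fin (n + 1))) (Fin.last n) = (‖w‖ ^ 2 + 4)⁻¹ * (‖w‖ ^ 2 - 4) := by
    intro w
    have hw : inner ℝ v (w : EuclideanSpace ℝ (Fin (n + 1))) = 0 :=
      Submodule.mem_orthogonal_singleton_iff_inner_right.1 w.2
    have : (((stereographic hv).symm w : sphere (0 : EuclideanSpace ℝ (Fin (n + 1))) 1) :
        EuclideanSpace ℝ (Fin (n + 1))) = stereoInvFunAux v w := rfl
    rw [hco, this, stereoInvFunAux_apply, inner_smul_right, inner_add_right, inner_smul_right,
      inner_smul_right, hw, real_inner_self_eq_norm_sq, hv]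
    simp
  have hiff : ∀ w : (Submodule.span ℝ {v})ᗮ,
      (((stereographic hv).symm w : sphere (0 : EuclideanSpace ℝ (Fin (n + 1))) 1) :
        EuclideanSpace ℝ (Fin (n + 1))) (Fin.last n) ≤ 0 ↔ ‖w‖ ≤ 2 := by
    intro w
    rw [hval]
    have h4 : 0 < (‖w‖ ^ 2 + 4)⁻¹ := by positivity
    have h0 := norm_nonneg w
    constructor
    · intro h
      by_contra hlt
      have : 0 < (‖w‖ ^ 2 + 4)⁻¹ * (‖w‖ ^ 2 - 4) := mul_pos h4 (by nlinarith)
      linarith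
    · intro h
      exact mul_nonpos_of_nonneg_of_nonpos h4.le (by nlinarith)
  ext x
  simp only [mem_ofPred_eq, mem_image, mem_closedBall_zero_iff]
  constructor
  · intro hx
    have hxs : x ∈ (stereographic hv).source := by
      rw [stereographic_source]
      intro h
      rw [mem_singleton_iff] at h
      rw [h] at hx
      simp only [hvdef] at hx
      simp at hx
      linarith
    have := (stereographic hv).left_inv hxs
    refine ⟨stereographic hv x, ?_, this⟩
    rw [← hiff, this]
    exact hx
  · rintro ⟨w, hw, rfl⟩
    exact (hiff w).2 hw

end sphere

end Decomp

/-- **Decomposition Theorem (Moore, Meyer, Daverman).** A null sequence of pairwise disjoint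
flat `n`-cells contained in an open set `U ⊆ S^n` can be collapsed to points by a continuous
surjection of `S^n` which is the identity outside `U` and is bijective off the collapsed cells. -/
theorem decomposition_theorem (n : ℕ) (hn : 2 ≤ n)
    (B : ℕ → Set (Euc (n+1)))
    (hBflat : ∀ i, IsFlatCell n (B i))
    (hBdisj : ∀ i j, i ≠ j → Disjoint (B i) (B j))
    (hBnull : Filter.Tendsto (fun i => Metric.diam (B i)) Filter.atTop (nhds 0))
    (U : Set (Euc (n+1))) (hUsub : U ⊆ Sph n)
    (hUopen : IsOpen {x : ↥(Sph n) | (x : Euc (n+1)) ∈ U})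
    (hBU : ∀ i, B i ⊆ U) :
    ∃ f : ↥(Sph n) → ↥(Sph n),
      Continuous f ∧ Function.Surjective f ∧
      (∀ x : ↥(Sph n), (x : Euc (n+1)) ∉ U → f x = x) ∧
      ∃ p : ℕ → ↥(Sph n),
        (∀ i, ((p i : Euc (n+1)) ∈ U)) ∧
        (∀ i, f ⁻¹' {p i} = {x : ↥(Sph n) | (x : Euc (n+1)) ∈ B i}) ∧
        Set.BijOn f
          {x : ↥(Sph n) | ∀ i, (x : Euc (n+1)) ∉ B i}
          {y : ↥(Sph n) | ∀ i, y ≠ p i} := by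
  set v : EuclideanSpace ℝ (Fin (n + 1)) := EuclideanSpace.single (Fin.last n) (1 : ℝ) with hvdef
  have hv : ‖v‖ = 1 := by simp [hvdef]
  let A : ℕ → Set (Sph n) := fun i => {x | (x : Euc (n+1)) ∈ B i}
  have himg : ∀ i, Subtype.val '' A i = B i := by
    intro i
    ext y
    constructor
    · rintro ⟨x, hx, rfl⟩
      exact hx
    · intro hy
      exact ⟨⟨y, (hBflat i).1 hy⟩, hy, rfl⟩
  have hdiam : ∀ i, diam (A i) = diam (B i) := by
    intro i
    rw [← himg i]
    exact (isometry_subtype_coe.diam_image (A i)).symm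
  have hnull : Decomp.Null A := by
    intro ε hε
    have h := hBnull.eventually (gt_mem_nhds hε)
    rw [← Nat.cofinite_eq_atTop, Filter.eventually_cofinite] at h
    refine h.subset fun i hi => ?_
    simp only [Set.mem_ofPred_eq] at hi ⊢
    rw [hdiam] at hi
    exact not_lt.2 hi.le
  have hstd : ∀ i, Decomp.Std (Submodule.span ℝ {v})ᗮ (A i) := by
    intro i
    obtain ⟨F, hF⟩ := (hBflat i).2
    have h1 : Decomp.Std (Submodule.span ℝ {v})ᗮ
        {x : ↥(Sph n) | (x : Euc (n+1)) (Fin.last n) ≤ 0} :=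
      ⟨_, isOpenEmbedding_stereographic_symm hv, Decomp.hemisphere_std n v hv hvdef⟩
    have h2 := h1.image F.symm
    rw [← hF, Set.image_image] at h2
    simpa using h2
  exact Decomp.main_abstract (E := (Submodule.span ℝ {v})ᗮ) A hnull hstd
    (fun i j hij => Set.disjoint_left.2 fun x hx hy =>
      Set.disjoint_left.1 (hBdisj i j hij) hx hy)
    {x | (x : Euc (n+1)) ∈ U} hUopen (fun i x hx => hBU i hx)
end
end
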